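/- Fix 0 < R₁ < R₂. There exist constants c > 0, C > 0 and δ₀ ∈ (0, 1) such that for all δ ∈ (0, δ₀): c/|log δ| ≤ λ₁(B_{R₂}⁺ \ K_δ⁺) − λ₁(B_{R₂}⁺) ≤ C/|log δ|. (This is the order of the two-term asymptotic expansion of λ₁^{DND} as the crack closes, ε = π/2 − δ → π/2.) -/

import Mathlib

open MeasureTheory Real Set

noncomputable section

/-- A Dirichlet test function on `ω`: smooth, compactly supported, with support in `ω`. -/
def testFun (ω : Set (ℝ × ℝ)) (u : (ℝ × ℝ) → ℝ) : Prop :=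
  ContDiff ℝ (⊤ : ℕ∞) u ∧ HasCompactSupport u ∧ tsupport u ⊆ ω

/-- `|∇u|²` at a point. -/
def gradSq (u : (ℝ × ℝ) → ℝ) (x : ℝ × ℝ) : ℝ :=
  fderiv ℝ u x (1, 0) ^ 2 + fderiv ℝ u x (0, 1) ^ 2

/-- The Rayleigh quotient of `u` on `ω`. -/
def rayleigh (ω : Set (ℝ × ℝ)) (u : (ℝ × ℝ) → ℝ) : ℝ :=
  (∫ x in ω, gradSq u x) / ∫ x in ω, u x ^ 2

/-- The `k`-th Dirichlet eigenvalue of `ω` (`k ≥ 1`), via the Courant–Fischer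
min-max formula over `k`-dimensional subspaces of `C_c^∞(ω)`. -/
def dirichletEV (ω : Set (ℝ × ℝ)) (k : ℕ) : ℝ :=
  sInf {l | ∃ V : Submodule ℝ ((ℝ × ℝ) → ℝ),
    (V : Set ((ℝ × ℝ) → ℝ)) ⊆ {u | testFun ω u} ∧ Module.finrank ℝ V = k ∧
    l = sSup {r | ∃ u ∈ V, u ≠ 0 ∧ r = rayleigh ω u}}

/-- The open disk `B_R` centered at the origin. -/
def disk (R : ℝ) : Set (ℝ × ℝ) := {x | x.1 ^ 2 + x.2 ^ 2 < R ^ 2}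

/-- The open annulus `M_{R₁,R₂} = B_{R₂} \ closure (B_{R₁})`. -/
def annulus (R₁ R₂ : ℝ) : Set (ℝ × ℝ) := disk R₂ \ closure (disk R₁)

/-- `D_{R₁,R₂} = B_{R₁} ∪ M_{R₁,R₂}`. -/
def diskUnionAnnulus (R₁ R₂ : ℝ) : Set (ℝ × ℝ) := disk R₁ ∪ annulus R₁ R₂

/-- The cracked domain `𝔇(N,ε)`. -/
def crackedDomain (R₁ R₂ : ℝ) (N : ℕ) (ε : ℝ) : Set (ℝ × ℝ) :=
  diskUnionAnnulus R₁ R₂ ∪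
    ⋃ j ∈ Finset.range N, {x | ∃ θ : ℝ, θ ∈ Set.Ioo (2 * π * j / N - ε) (2 * π * j / N + ε) ∧
      x = (R₁ * Real.cos θ, R₁ * Real.sin θ)}

/-- The first Dirichlet eigenvalue of `ω`: the infimum of the Rayleigh quotient over
nonzero functions in `C_c^∞(ω)`. -/
def lambda1 (ω : Set (ℝ × ℝ)) : ℝ :=
  sInf {r | ∃ u, testFun ω u ∧ u ≠ 0 ∧ r = rayleigh ω u}

/-- The open upper half-disk `B_R⁺ = B_R ∩ {x₂ > 0}`. -/
def halfDisk (R : ℝ) : Set (ℝ × ℝ) := disk R ∩ {x | 0 < x.2}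

/-- The compact set `K_δ`: two closed arcs of angular half-width `δ` on the circle of radius
`R₁`, centered at the points `(0, R₁)` and `(0, −R₁)`. -/
def crackSet (R₁ δ : ℝ) : Set (ℝ × ℝ) :=
  {x | ∃ θ : ℝ, (θ ∈ Set.Icc (π / 2 - δ) (π / 2 + δ) ∨
      θ ∈ Set.Icc (-(π / 2) - δ) (-(π / 2) + δ)) ∧
    x = (R₁ * Real.cos θ, R₁ * Real.sin θ)}

/-- `K_δ⁺ = K_δ ∩ {x₂ > 0}`. -/
def crackSetPlus (R₁ δ : ℝ) : Set (ℝ × ℝ) := crackSet R₁ δ ∩ {x | 0 < x.2}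

/-- The entire function `∑ (-t)^k / (k! (k+n)!)`, which is `t^(-n/2) J_n(2√t)` for `t > 0`. -/
def besselClifford (n : ℕ) (t : ℝ) : ℝ :=
  ∑' k : ℕ, (-t) ^ k / (k.factorial * (k + n).factorial)

lemma norm_besselClifford_term_le (n k : ℕ) (t : ℝ) :
    ‖(-t) ^ k / ((k.factorial : ℝ) * (k + n).factorial)‖ ≤ |t| ^ k / k.factorial := by
  rw [norm_div, norm_pow, norm_neg, Real.norm_eq_abs, Real.norm_of_nonneg (by positivity)]
  gcongr
  have : (1 : ℝ) ≤ (k + n).factorial := by exact_mod_cast Nat.succ_le_of_lt (Nat.factorial_pos _)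
  exact le_mul_of_one_le_right (by positivity) this

lemma summable_besselClifford (n : ℕ) (t : ℝ) :
    Summable fun k : ℕ => (-t) ^ k / ((k.factorial : ℝ) * (k + n).factorial) :=
  .of_norm_bounded (Real.summable_pow_div_factorial |t|)
    fun k => norm_besselClifford_term_le n k t

lemma hasDerivAt_besselClifford (n : ℕ) (t : ℝ) :
    HasDerivAt (besselClifford n) (-besselClifford (n + 1) t) t := by
  set R := |t| + 1
  have hR : 0 < R := by positivity
  let g' : ℕ → ℝ → ℝ := fun k y =>
    ((k : ℝ) * (-y) ^ (k - 1) * (-1)) / ((k.factorial : ℝ) * (k + n).factorial)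
  have hu : Summable fun k : ℕ => (k : ℝ) * R ^ (k - 1) / k.factorial := by
    refine (summable_nat_add_iff 1).1 ?_
    refine (Real.summable_pow_div_factorial R).congr fun k => ?_
    rw [Nat.factorial_succ]
    push_cast
    have : (k.factorial : ℝ) ≠ 0 := by positivity
    field_simp
  have hg' : ∀ k y, y ∈ Metric.ball (0 : ℝ) R → ‖g' k y‖ ≤ (k : ℝ) * R ^ (k - 1) / k.factorial := by
    intro k y hy
    have hy' : |y| ≤ R := by simpa using (mem_ball_zero_iff.1 hy).le
    have h1 : (1 : ℝ) ≤ (k + n).factorial := by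
      exact_mod_cast Nat.succ_le_of_lt (Nat.factorial_pos _)
    simp only [g', norm_div, norm_mul, norm_pow, norm_neg, norm_one, mul_one, Real.norm_eq_abs,
      Nat.abs_cast]
    gcongr
    exact le_mul_of_one_le_right (by positivity) h1
  have key : HasDerivAt (besselClifford n) (∑' k, g' k t) t := by
    refine hasDerivAt_tsum_of_isPreconnected hu Metric.isOpen_ball
      (convex_ball (0 : ℝ) R).isPreconnected (fun k y _ => ?_) hg' (Metric.mem_ball_self hR)
      (summable_besselClifford n 0) ?_
    · exact ((hasDerivAt_id y).neg.pow k).div_const _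
    · simp [R]
  convert key using 1
  have hs : Summable fun k => g' k t := .of_norm_bounded hu fun k => hg' k t (by simp [R])
  rw [hs.tsum_eq_zero_add]
  simp only [besselClifford, ← tsum_neg]
  simp only [g']
  simp only [Nat.cast_zero, zero_mul, zero_div, zero_add]
  refine tsum_congr fun k => ?_
  rw [Nat.factorial_succ, show k + 1 + n = k + (n + 1) by ring]
  have h1 : (k.factorial : ℝ) ≠ 0 := by positivity
  have h2 : ((k + (n + 1)).factorial : ℝ) ≠ 0 := by positivity
  push_cast
  field_simp

lemma contDiff_besselClifford (n : ℕ) : ContDiff ℝ (⊤ : ℕ∞) (besselClifford n) := by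
  have H : ∀ m n : ℕ, ContDiff ℝ m (besselClifford n) := by
    intro m
    induction m with
    | zero =>
      intro n
      exact contDiff_zero.2
        (continuous_iff_continuousAt.2 fun t => (hasDerivAt_besselClifford n t).continuousAt)
    | succ m ih =>
      intro n
      rw [Nat.cast_succ, contDiff_succ_iff_deriv]
      refine ⟨fun t => (hasDerivAt_besselClifford n t).differentiableAt, by simp, ?_⟩
      rw [show deriv (besselClifford n) = fun t => -besselClifford (n + 1) t from
        funext fun t => (hasDerivAt_besselClifford n t).deriv]
      exact (ih (n + 1)).neg
  exact contDiff_infty.2 fun m => H m n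

lemma besselClifford_recurrence (n : ℕ) (t : ℝ) :
    besselClifford n t = (n + 1) * besselClifford (n + 1) t - t * besselClifford (n + 2) t := by
  have h0 := summable_besselClifford n t
  have h1 := (summable_besselClifford (n + 1) t).mul_left ((n : ℝ) + 1)
  have h2 := summable_besselClifford (n + 2) t
  have e : t * besselClifford (n + 2) t
      = ∑' k : ℕ, ((n + 1) * ((-t) ^ k / ((k.factorial : ℝ) * (k + (n + 1)).factorial))
          - (-t) ^ k / ((k.factorial : ℝ) * (k + n).factorial)) := by
    rw [(h1.sub h0).tsum_eq_zero_add, besselClifford, ← tsum_mul_left]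
    have hz : ((n : ℝ) + 1) * ((-t) ^ 0 / (((0 : ℕ).factorial : ℝ) * (0 + (n + 1)).factorial))
          - (-t) ^ 0 / (((0 : ℕ).factorial : ℝ) * (0 + n).factorial) = 0 := by
      simp only [zero_add, pow_zero, Nat.factorial_succ, Nat.factorial_zero]
      push_cast
      have : (n.factorial : ℝ) ≠ 0 := by positivity
      field_simp
      ring
    rw [hz, zero_add]
    refine tsum_congr fun k => ?_
    rw [show k + 1 + (n + 1) = (k + n + 1) + 1 by ring, show k + 1 + n = k + n + 1 by ring,
      show k + (n + 2) = (k + n + 1) + 1 by ring, Nat.factorial_succ (k + n + 1),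
      Nat.factorial_succ k]
    push_cast
    have h3 : (k.factorial : ℝ) ≠ 0 := by positivity
    have h4 : ((k + n + 1).factorial : ℝ) ≠ 0 := by positivity
    have h5 : (k : ℝ) + n + 1 + 1 ≠ 0 := by positivity
    field_simp
    ring
  rw [e, h1.tsum_sub h0, tsum_mul_left]
  simp only [besselClifford]
  ring

lemma besselClifford_zero_right (n : ℕ) : besselClifford n 0 = 1 / n.factorial := by
  rw [besselClifford, tsum_eq_single 0]
  · simp
  · intro k hk
    simp [hk]

lemma besselClifford_one_four_neg : besselClifford 1 4 < 0 := by
  have hs := summable_besselClifford 1 4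
  have ht := hs.sum_add_tsum_nat_add 6
  have hb : ‖∑' k : ℕ, (-(4 : ℝ)) ^ (k + 6) / (((k + 6).factorial : ℝ) * (k + 6 + 1).factorial)‖
      ≤ 4 ^ 6 / (720 * 5040) * 2 := by
    refine tsum_of_norm_bounded (hasSum_geometric_two.mul_left _) fun k => ?_
    induction k with
    | zero => norm_num [Nat.factorial]
    | succ k ih =>
      have hk : (-(4 : ℝ)) ^ (k + 1 + 6) / (((k + 1 + 6).factorial : ℝ) * (k + 1 + 6 + 1).factorial)
          = (-(4 : ℝ)) ^ (k + 6) / (((k + 6).factorial : ℝ) * (k + 6 + 1).factorial)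
            * (-4 / ((k + 7) * (k + 8))) := by
        rw [show k + 1 + 6 = k + 6 + 1 by ring, Nat.factorial_succ (k + 6 + 1),
          Nat.factorial_succ (k + 6)]
        push_cast
        have h3 : ((k + 6).factorial : ℝ) ≠ 0 := by positivity
        field_simp
        ring
      rw [hk, norm_mul, pow_succ (1 / 2 : ℝ), ← mul_assoc]
      refine mul_le_mul ih ?_ (norm_nonneg _) (by positivity)
      rw [norm_div, Real.norm_of_nonneg (by positivity : (0 : ℝ) ≤ (k + 7) * (k + 8)),
        div_le_div_iff₀ (by positivity) (by norm_num)]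
      norm_num
      nlinarith [(Nat.cast_nonneg k : (0 : ℝ) ≤ k)]
  rw [besselClifford, ← ht]
  have := (abs_le.1 (by simpa only [Real.norm_eq_abs] using hb)).2
  norm_num [Finset.sum_range_succ, Nat.factorial] at this ⊢
  linarith

/-- The radial part of the first Dirichlet eigenfunction of the half-disk of radius `R`, as a
function of the squared distance to the origin. -/
lemma exists_radial_profile (R : ℝ) (hR : 0 < R) :
    ∃ (G G₁ G₂ : ℝ → ℝ) (μ : ℝ), ContDiff ℝ (⊤ : ℕ∞) G ∧
      (∀ s, HasDerivAt G (G₁ s) s) ∧ (∀ s, HasDerivAt G₁ (G₂ s) s) ∧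
      (∀ s, 4 * s * G₂ s + 8 * G₁ s = -μ * G s) ∧ G (R ^ 2) = 0 ∧
      (∀ s ∈ Ico 0 (R ^ 2), 0 < G s) ∧ ∀ s ∈ Icc 0 (R ^ 2), G₁ s ≤ 0 := by
  have hc : Continuous (besselClifford 1) := (contDiff_besselClifford 1).continuous
  have h0 : 0 < besselClifford 1 0 := by rw [besselClifford_zero_right]; positivity
  obtain ⟨z, hz, hz0⟩ : (0 : ℝ) ∈ image (besselClifford 1) (Icc 0 4) :=
    intermediate_value_Icc' (by norm_num) hc.continuousOn ⟨besselClifford_one_four_neg.le, h0.le⟩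
  let Z : Set ℝ := Ici 0 ∩ besselClifford 1 ⁻¹' {0}
  have hZc : IsClosed Z := isClosed_Ici.inter (isClosed_singleton.preimage hc)
  have hZb : BddBelow Z := ⟨0, fun t ht => ht.1⟩
  have hZ : sInf Z ∈ Z := hZc.csInf_mem ⟨z, hz.1, hz0⟩ hZb
  set t₀ := sInf Z with ht₀
  have hzero : besselClifford 1 t₀ = 0 := hZ.2
  have ht₀pos : 0 < t₀ := by
    refine lt_of_le_of_ne hZ.1 fun h => ?_
    rw [← h] at hzero
    exact h0.ne' hzero
  have hpos : ∀ t ∈ Ico 0 t₀, 0 < besselClifford 1 t := by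
    intro t ht
    by_contra! hle
    obtain ⟨w, hw, hw0⟩ : (0 : ℝ) ∈ image (besselClifford 1) (Icc 0 t) :=
      intermediate_value_Icc' ht.1 hc.continuousOn ⟨hle, h0.le⟩
    exact absurd (csInf_le hZb ⟨hw.1, hw0⟩) (not_le.2 (lt_of_le_of_lt hw.2 ht.2))
  have hnonneg : ∀ t ∈ Icc 0 t₀, 0 ≤ besselClifford 2 t := by
    have hd : ∀ t, HasDerivAt (fun t => t ^ 2 * besselClifford 2 t) (t * besselClifford 1 t) t := by
      intro t
      refine ((hasDerivAt_pow 2 t).mul (hasDerivAt_besselClifford 2 t)).congr_deriv ?_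
      rw [besselClifford_recurrence 1 t]
      norm_num
      ring
    have hm : MonotoneOn (fun t => t ^ 2 * besselClifford 2 t) (Icc 0 t₀) := by
      refine monotoneOn_of_deriv_nonneg (convex_Icc _ _)
        (continuous_iff_continuousAt.2 fun t => (hd t).continuousAt).continuousOn
        (fun t _ => (hd t).differentiableAt.differentiableWithinAt) fun t ht => ?_
      rw [interior_Icc] at ht
      rw [(hd t).deriv]
      exact mul_nonneg ht.1.le (hpos t ⟨ht.1.le, ht.2⟩).le
    intro t ht
    rcases ht.1.eq_or_lt with h | h
    · rw [← h, besselClifford_zero_right]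
      positivity
    · have := hm (left_mem_Icc.2 ht₀pos.le) ht ht.1
      simp only [ne_eq, OfNat.ofNat_ne_zero, not_false_eq_true, zero_pow, zero_mul] at this
      exact nonneg_of_mul_nonneg_right this (by positivity)
  set ν := t₀ / R ^ 2 with hν
  have hνpos : 0 < ν := by positivity
  have hνR : ν * R ^ 2 = t₀ := by rw [hν]; field_simp
  have hd : ∀ n s, HasDerivAt (fun s => besselClifford n (ν * s))
      (-ν * besselClifford (n + 1) (ν * s)) s := by
    intro n s
    refine ((hasDerivAt_besselClifford n (ν * s)).comp s
      ((hasDerivAt_id s).const_mul ν)).congr_deriv ?_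
    ring
  refine ⟨fun s => besselClifford 1 (ν * s), fun s => -ν * besselClifford 2 (ν * s),
    fun s => -ν * (-ν * besselClifford 3 (ν * s)), 4 * ν,
    (contDiff_besselClifford 1).comp (contDiff_const.mul contDiff_id), hd 1,
    fun s => (hd 2 s).const_mul _, fun s => ?_, ?_, fun s hs => ?_, fun s hs => ?_⟩
  · simp only [besselClifford_recurrence 1 (ν * s)]
    norm_num
    ring
  · simp only [hνR, hzero]
  · refine hpos _ ⟨mul_nonneg hνpos.le hs.1, ?_⟩
    rw [← hνR]
    exact mul_lt_mul_of_pos_left hs.2 hνpos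
  · have := hnonneg (ν * s) ⟨mul_nonneg hνpos.le hs.1,
      by rw [← hνR]; exact mul_le_mul_of_nonneg_left hs.2 hνpos.le⟩
    nlinarith

lemma integral_fderiv_apply_eq_zero {F : ℝ × ℝ → ℝ} (hF : ContDiff ℝ 1 F)
    (hc : HasCompactSupport F) (e : ℝ × ℝ) : ∫ p, fderiv ℝ F p e = 0 := by
  have hcont : Continuous fun p => fderiv ℝ F p e :=
    (hF.continuous_fderiv one_ne_zero).clm_apply continuous_const
  have h_int : Integrable fun p => fderiv ℝ F p e :=
    hcont.integrable_of_hasCompactSupport (hc.fderiv_apply (𝕜 := ℝ) e)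
  have h_int' : Integrable F := hF.continuous.integrable_of_hasCompactSupport hc
  have := integral_mul_fderiv_eq_neg_fderiv_mul_of_integrable (μ := (volume : Measure (ℝ × ℝ)))
    (f := F) (g := fun _ => (1 : ℝ)) (v := e) (by simpa using h_int) (by simp)
    (by simpa using h_int')
    (fun p _ => (hF.differentiable one_ne_zero).differentiableAt)
    (fun p _ => differentiableAt_const _)
  simpa using this.symm

lemma continuous_gradSq {u : ℝ × ℝ → ℝ} (hu : ContDiff ℝ 1 u) : Continuous (gradSq u) := by
  have := hu.continuous_fderiv one_ne_zero
  unfold gradSq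
  exact ((this.clm_apply continuous_const).pow 2).add ((this.clm_apply continuous_const).pow 2)

lemma gradSq_nonneg (u : ℝ × ℝ → ℝ) (p : ℝ × ℝ) : 0 ≤ gradSq u p := by
  unfold gradSq; positivity

lemma gradSq_eq_zero_of_notMem_tsupport {u : ℝ × ℝ → ℝ} {p : ℝ × ℝ} (hp : p ∉ tsupport u) :
    gradSq u p = 0 := by
  have : fderiv ℝ u p = 0 := by
    by_contra h
    exact hp (support_fderiv_subset ℝ (Function.mem_support.2 h))
  simp [gradSq, this]

lemma HasCompactSupport.of_imp_eq_zero {f g : ℝ × ℝ → ℝ} (hf : HasCompactSupport f)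
    (h : ∀ p, f p = 0 → g p = 0) : HasCompactSupport g :=
  hf.mono fun p hp hfp => hp (h p hfp)

lemma fderiv_mul_apply {f g : ℝ × ℝ → ℝ} (hf : Differentiable ℝ f) (hg : Differentiable ℝ g)
    (p e : ℝ × ℝ) :
    fderiv ℝ (fun q => f q * g q) p e = f p * fderiv ℝ g p e + g p * fderiv ℝ f p e := by
  rw [fderiv_fun_mul (hf p) (hg p)]
  simp

lemma fderiv_sq_apply {f : ℝ × ℝ → ℝ} (hf : Differentiable ℝ f) (p e : ℝ × ℝ) :
    fderiv ℝ (fun q => f q ^ 2) p e = 2 * f p * fderiv ℝ f p e := by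
  rw [fderiv_fun_pow 2 (hf p)]
  simp

lemma contDiff_fderiv_apply {f : ℝ × ℝ → ℝ} (hf : ContDiff ℝ (⊤ : ℕ∞) f) (e : ℝ × ℝ) :
    ContDiff ℝ (⊤ : ℕ∞) fun q => fderiv ℝ f q e :=
  (hf.fderiv_right (m := (⊤ : ℕ∞)) (by simp)).clm_apply contDiff_const

/-- The ground state representation of the Dirichlet energy of `φ v`, where `-Δφ = μ φ`. -/
lemma integral_gradSq_mul {φ v : ℝ × ℝ → ℝ} {μ : ℝ} (hφ : ContDiff ℝ (⊤ : ℕ∞) φ)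
    (hΔ : ∀ p, fderiv ℝ (fun q => fderiv ℝ φ q (1, 0)) p (1, 0)
      + fderiv ℝ (fun q => fderiv ℝ φ q (0, 1)) p (0, 1) = -μ * φ p)
    (hv : ContDiff ℝ (⊤ : ℕ∞) v) (hvc : HasCompactSupport v) :
    ∫ p, gradSq (fun q => φ q * v q) p
      = μ * (∫ p, (φ p * v p) ^ 2) + ∫ p, φ p ^ 2 * gradSq v p := by
  have hφd : Differentiable ℝ φ := hφ.differentiable (by simp)
  have hvd : Differentiable ℝ v := hv.differentiable (by simp)
  let F : ℝ × ℝ → ℝ × ℝ → ℝ := fun e q => fderiv ℝ φ q e * (φ q * v q ^ 2)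
  have hF : ∀ e, ContDiff ℝ (⊤ : ℕ∞) (F e) := fun e =>
    (contDiff_fderiv_apply hφ e).mul (hφ.mul (hv.pow 2))
  have hv2 : HasCompactSupport fun q => v q ^ 2 := hvc.of_imp_eq_zero fun p hp => by simp [hp]
  have hFc : ∀ e, HasCompactSupport (F e) := fun e => (hv2.mul_left (f := φ)).mul_left
  have hF0 : ∀ e, ∫ p, fderiv ℝ (F e) p e = 0 := fun e =>
    integral_fderiv_apply_eq_zero ((hF e).of_le (by exact_mod_cast le_top)) (hFc e) e
  have hFi : ∀ e, Integrable fun p => fderiv ℝ (F e) p e := fun e =>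
    (contDiff_fderiv_apply (hF e) e).continuous.integrable_of_hasCompactSupport
      ((hFc e).fderiv_apply (𝕜 := ℝ) e)
  have hv1 : ContDiff ℝ 1 v := hv.of_le (by exact_mod_cast le_top)
  have hgc : HasCompactSupport (gradSq v) :=
    HasCompactSupport.intro hvc fun p hp => gradSq_eq_zero_of_notMem_tsupport hp
  have hi1 : Integrable fun p => μ * (φ p * v p) ^ 2 := by
    refine Continuous.integrable_of_hasCompactSupport ?_ ?_
    · exact continuous_const.mul ((hφ.continuous.mul hv.continuous).pow 2)
    · exact hvc.of_imp_eq_zero fun p hp => by simp [hp]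
  have hi2 : Integrable fun p => φ p ^ 2 * gradSq v p :=
    ((hφ.continuous.pow 2).mul (continuous_gradSq hv1)).integrable_of_hasCompactSupport
      hgc.mul_left
  have hpt : ∀ p, gradSq (fun q => φ q * v q) p = (μ * (φ p * v p) ^ 2 + φ p ^ 2 * gradSq v p)
      + (fderiv ℝ (F (1, 0)) p (1, 0) + fderiv ℝ (F (0, 1)) p (0, 1)) := by
    intro p
    have h2 : ∀ e, Differentiable ℝ fun q => fderiv ℝ φ q e := fun e =>
      (contDiff_fderiv_apply hφ e).differentiable (by simp)
    have hv2d : Differentiable ℝ fun q => v q ^ 2 := hvd.pow 2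
    have hFe : ∀ e, fderiv ℝ (F e) p e
        = fderiv ℝ φ p e * (φ p * (2 * v p * fderiv ℝ v p e) + v p ^ 2 * fderiv ℝ φ p e)
          + φ p * v p ^ 2 * fderiv ℝ (fun q => fderiv ℝ φ q e) p e := by
      intro e
      rw [fderiv_mul_apply (h2 e) (hφd.fun_mul hv2d), fderiv_mul_apply hφd hv2d,
        fderiv_sq_apply hvd]
    rw [hFe, hFe]
    simp only [gradSq, fderiv_mul_apply hφd hvd]
    linear_combination (-(φ p * v p ^ 2)) * hΔ p
  simp_rw [hpt]
  have hi12 : Integrable fun p => μ * (φ p * v p) ^ 2 + φ p ^ 2 * gradSq v p := hi1.add hi2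
  have hF12 : Integrable fun p => fderiv ℝ (F (1, 0)) p (1, 0) + fderiv ℝ (F (0, 1)) p (0, 1) :=
    (hFi _).add (hFi _)
  rw [integral_add hi12 hF12, integral_add hi1 hi2,
    integral_add (hFi _) (hFi _), hF0, hF0, integral_const_mul]
  ring

/-- A lower bound for the weighted Dirichlet energy from a vector field `(Y₁, Y₂)`, obtained by
completing the square. -/
lemma integral_field_le {φ v Y₁ Y₂ : ℝ × ℝ → ℝ} (hφ : ContDiff ℝ (⊤ : ℕ∞) φ)
    (hv : ContDiff ℝ (⊤ : ℕ∞) v) (hvc : HasCompactSupport v)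
    (hY₁ : ContDiff ℝ (⊤ : ℕ∞) Y₁) (hY₂ : ContDiff ℝ (⊤ : ℕ∞) Y₂) {W : ℝ × ℝ → ℝ}
    (hWi : Integrable W)
    (hW : ∀ p, v p ≠ 0 → W p ≤ -(φ p ^ 2 * v p ^ 2
        * (fderiv ℝ Y₁ p (1, 0) + fderiv ℝ Y₂ p (0, 1) + Y₁ p ^ 2 + Y₂ p ^ 2)
      + 2 * φ p * v p ^ 2 * (fderiv ℝ φ p (1, 0) * Y₁ p + fderiv ℝ φ p (0, 1) * Y₂ p)))
    (hW0 : ∀ p, v p = 0 → W p ≤ 0) :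
    ∫ p, W p ≤ ∫ p, φ p ^ 2 * gradSq v p := by
  have hφd : Differentiable ℝ φ := hφ.differentiable (by simp)
  have hvd : Differentiable ℝ v := hv.differentiable (by simp)
  have hv2 : HasCompactSupport fun q => v q ^ 2 := hvc.of_imp_eq_zero fun p hp => by simp [hp]
  have hv1 : ContDiff ℝ 1 v := hv.of_le (by exact_mod_cast le_top)
  have hgc : HasCompactSupport (gradSq v) :=
    HasCompactSupport.intro hvc fun p hp => gradSq_eq_zero_of_notMem_tsupport hp
  have hi2 : Integrable fun p => φ p ^ 2 * gradSq v p :=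
    ((hφ.continuous.pow 2).mul (continuous_gradSq hv1)).integrable_of_hasCompactSupport
      hgc.mul_left
  have main : ∀ Y : ℝ × ℝ → ℝ, ContDiff ℝ (⊤ : ℕ∞) Y → ∀ e,
      (∫ p, fderiv ℝ (fun q => φ q ^ 2 * (v q ^ 2 * Y q)) p e = 0) ∧
      (Integrable fun p => fderiv ℝ (fun q => φ q ^ 2 * (v q ^ 2 * Y q)) p e) ∧
      ∀ p, fderiv ℝ (fun q => φ q ^ 2 * (v q ^ 2 * Y q)) p e
        = φ p ^ 2 * (v p ^ 2 * fderiv ℝ Y p e + Y p * (2 * v p * fderiv ℝ v p e))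
          + v p ^ 2 * Y p * (2 * φ p * fderiv ℝ φ p e) := by
    intro Y hY e
    have hYd : Differentiable ℝ Y := hY.differentiable (by simp)
    have hs : ContDiff ℝ (⊤ : ℕ∞) fun q => φ q ^ 2 * (v q ^ 2 * Y q) :=
      (hφ.pow 2).mul ((hv.pow 2).mul hY)
    have hc : HasCompactSupport fun q => φ q ^ 2 * (v q ^ 2 * Y q) :=
      (hv2.mul_right (f' := Y)).mul_left (f := fun q => φ q ^ 2)
    refine ⟨integral_fderiv_apply_eq_zero (hs.of_le (by exact_mod_cast le_top)) hc e,
      (contDiff_fderiv_apply hs e).continuous.integrable_of_hasCompactSupport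
      (hc.fderiv_apply (𝕜 := ℝ) e), fun p => ?_⟩
    have hv2d : Differentiable ℝ fun q => v q ^ 2 := hvd.pow 2
    have hφ2d : Differentiable ℝ fun q => φ q ^ 2 := hφd.pow 2
    rw [fderiv_mul_apply hφ2d (hv2d.fun_mul hYd), fderiv_mul_apply hv2d hYd,
      fderiv_sq_apply hvd, fderiv_sq_apply hφd]
  obtain ⟨h10, h1i, h1⟩ := main Y₁ hY₁ (1, 0)
  obtain ⟨h20, h2i, h2⟩ := main Y₂ hY₂ (0, 1)
  have hle : ∫ p, (W p + (fderiv ℝ (fun q => φ q ^ 2 * (v q ^ 2 * Y₁ q)) p (1, 0)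
      + fderiv ℝ (fun q => φ q ^ 2 * (v q ^ 2 * Y₂ q)) p (0, 1)))
      ≤ ∫ p, φ p ^ 2 * gradSq v p := by
    refine integral_mono (hWi.add (h1i.add h2i)) hi2 fun p => ?_
    simp only [h1, h2, gradSq]
    by_cases hp : v p = 0
    · have := hW0 p hp
      simp only [hp]
      nlinarith [sq_nonneg (φ p * fderiv ℝ v p (1, 0)), sq_nonneg (φ p * fderiv ℝ v p (0, 1))]
    · have := hW p hp
      nlinarith [sq_nonneg (φ p * (fderiv ℝ v p (1, 0) - v p * Y₁ p)),
        sq_nonneg (φ p * (fderiv ℝ v p (0, 1) - v p * Y₂ p))]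
  have h12i : Integrable fun p => fderiv ℝ (fun q => φ q ^ 2 * (v q ^ 2 * Y₁ q)) p (1, 0)
      + fderiv ℝ (fun q => φ q ^ 2 * (v q ^ 2 * Y₂ q)) p (0, 1) := h1i.add h2i
  rwa [integral_add hWi h12i, integral_add h1i h2i, h10, h20, add_zero, add_zero] at hle

/-- The squared Euclidean distance to the point `(0, d)`. -/
def sqDist (d : ℝ) (p : ℝ × ℝ) : ℝ := p.1 ^ 2 + (p.2 - d) ^ 2

lemma sqDist_nonneg (d : ℝ) (p : ℝ × ℝ) : 0 ≤ sqDist d p := by unfold sqDist; positivity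

lemma contDiff_sqDist (d : ℝ) : ContDiff ℝ (⊤ : ℕ∞) (sqDist d) :=
  (contDiff_fst.pow 2).add ((contDiff_snd.sub contDiff_const).pow 2)

lemma fderiv_sqDist_apply (d : ℝ) (p e : ℝ × ℝ) :
    fderiv ℝ (sqDist d) p e = 2 * p.1 * e.1 + 2 * (p.2 - d) * e.2 := by
  have h : HasFDerivAt (sqDist d) (((2 : ℕ) * p.1 ^ (2 - 1)) • ContinuousLinearMap.fst ℝ ℝ ℝ
      + ((2 : ℕ) * (p.2 - d) ^ (2 - 1)) • ContinuousLinearMap.snd ℝ ℝ ℝ) p := by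
    have h1 := (hasDerivAt_pow 2 p.1).comp_hasFDerivAt p (hasFDerivAt_fst (𝕜 := ℝ) (p := p))
    have h2 := (hasDerivAt_pow 2 (p.2 - d)).comp_hasFDerivAt p
      ((hasFDerivAt_snd (𝕜 := ℝ) (p := p)).sub_const d)
    exact h1.add h2
  rw [h.fderiv]
  simp

lemma fderiv_comp_apply {g : ℝ → ℝ} {g' : ℝ} {f : ℝ × ℝ → ℝ} {p : ℝ × ℝ}
    (hg : HasDerivAt g g' (f p)) (hf : DifferentiableAt ℝ f p) (e : ℝ × ℝ) :
    fderiv ℝ (fun q => g (f q)) p e = g' * fderiv ℝ f p e := by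
  have := hg.comp_hasFDerivAt p hf.hasFDerivAt
  rw [show (fun q => g (f q)) = g ∘ f from rfl, this.fderiv]
  simp

lemma exists_halfDisk_groundState (R₁ R₂ : ℝ) (hR₁ : 0 < R₁) (hR₁₂ : R₁ < R₂) :
    ∃ (φ : ℝ × ℝ → ℝ) (μ M : ℝ), ContDiff ℝ (⊤ : ℕ∞) φ ∧
      (∀ p, fderiv ℝ (fun q => fderiv ℝ φ q (1, 0)) p (1, 0)
        + fderiv ℝ (fun q => fderiv ℝ φ q (0, 1)) p (0, 1) = -μ * φ p) ∧
      (∀ p ∈ halfDisk R₂, 0 < φ p) ∧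
      (∀ p : ℝ × ℝ, p.1 ^ 2 + p.2 ^ 2 ≤ R₂ ^ 2 → 0 ≤ p.2 → p ∉ halfDisk R₂ → φ p = 0) ∧
      0 ≤ M ∧ ∀ p ∈ halfDisk R₂,
        fderiv ℝ φ p (1, 0) * p.1 + fderiv ℝ φ p (0, 1) * (p.2 - R₁)
          ≤ M * √(sqDist R₁ p) * φ p := by
  have hR₂ : 0 < R₂ := hR₁.trans hR₁₂
  obtain ⟨G, G₁, G₂, μ, hG, hG₁, hG₂, hode, hGR, hGpos, hG₁neg⟩ := exists_radial_profile R₂ hR₂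
  obtain ⟨N, hN0, hN⟩ : ∃ N, 0 ≤ N ∧ ∀ s ∈ Icc 0 (R₁ ^ 2), -G₁ s ≤ N * G s := by
    have hc : ContinuousOn (fun s => -G₁ s / G s) (Icc 0 (R₁ ^ 2)) := by
      refine ContinuousOn.div ?_ hG.continuous.continuousOn fun s hs => ?_
      · exact (continuous_iff_continuousAt.2 fun t => (hG₂ t).continuousAt).neg.continuousOn
      · exact (hGpos s ⟨hs.1, by nlinarith [hs.2]⟩).ne'
    obtain ⟨N, hN⟩ := isCompact_Icc.exists_bound_of_continuousOn hc
    refine ⟨max N 0, le_max_right _ _, fun s hs => ?_⟩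
    have hpos := hGpos s ⟨hs.1, by nlinarith [hs.2]⟩
    rw [← div_le_iff₀ hpos]
    exact (le_abs_self _).trans ((hN s hs).trans (le_max_left _ _))
  let φ : ℝ × ℝ → ℝ := fun p => p.2 * G (sqDist 0 p)
  have hs : Differentiable ℝ (sqDist 0) := (contDiff_sqDist 0).differentiable (by simp)
  have hcG : ∀ {g g' : ℝ → ℝ}, (∀ s, HasDerivAt g (g' s) s) →
      Differentiable ℝ fun q => g (sqDist 0 q) := fun h p =>
    ((h _).differentiableAt).comp p (hs p)
  have hsnd : Differentiable ℝ fun q : ℝ × ℝ => q.2 := differentiable_snd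
  have hfst : Differentiable ℝ fun q : ℝ × ℝ => q.1 := differentiable_fst
  have hsnd' : ∀ p e : ℝ × ℝ, fderiv ℝ (fun q : ℝ × ℝ => q.2) p e = e.2 := fun p e => by
    rw [hasFDerivAt_snd.fderiv]; rfl
  have hfst' : ∀ p e : ℝ × ℝ, fderiv ℝ (fun q : ℝ × ℝ => q.1) p e = e.1 := fun p e => by
    rw [hasFDerivAt_fst.fderiv]; rfl
  have hφe : ∀ p e, fderiv ℝ φ p e
      = p.2 * (G₁ (sqDist 0 p) * (2 * p.1 * e.1 + 2 * p.2 * e.2)) + G (sqDist 0 p) * e.2 := by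
    intro p e
    rw [fderiv_mul_apply hsnd (hcG hG₁), hsnd', fderiv_comp_apply (hG₁ _) (hs p),
      fderiv_sqDist_apply, sub_zero]
  have hmem : ∀ p, p ∈ halfDisk R₂ ↔ sqDist 0 p < R₂ ^ 2 ∧ 0 < p.2 := fun p => by
    simp [halfDisk, disk, sqDist]
  refine ⟨φ, μ, 1 / R₁ + 2 * R₁ * N, contDiff_snd.mul (hG.comp (contDiff_sqDist 0)),
    fun p => ?_, fun p hp => ?_, fun p hp hp2 hpn => ?_, by positivity, fun p hp => ?_⟩
  · have e1 : (fun q => fderiv ℝ φ q (1, 0)) = fun q => 2 * (q.1 * (q.2 * G₁ (sqDist 0 q))) := by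
      funext q; rw [hφe]; ring
    have e2 : (fun q => fderiv ℝ φ q (0, 1))
        = fun q => 2 * (q.2 * (q.2 * G₁ (sqDist 0 q))) + G (sqDist 0 q) := by
      funext q; rw [hφe]; ring
    have d1 : Differentiable ℝ fun q : ℝ × ℝ => q.2 * G₁ (sqDist 0 q) := hsnd.fun_mul (hcG hG₂)
    have d2 : Differentiable ℝ fun q : ℝ × ℝ => q.1 * (q.2 * G₁ (sqDist 0 q)) := hfst.fun_mul d1
    have d3 : Differentiable ℝ fun q : ℝ × ℝ => q.2 * (q.2 * G₁ (sqDist 0 q)) := hsnd.fun_mul d1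
    have f1 : ∀ e, fderiv ℝ (fun q : ℝ × ℝ => q.2 * G₁ (sqDist 0 q)) p e
        = p.2 * (G₂ (sqDist 0 p) * (2 * p.1 * e.1 + 2 * p.2 * e.2)) + G₁ (sqDist 0 p) * e.2 := by
      intro e
      rw [fderiv_mul_apply hsnd (hcG hG₂), hsnd', fderiv_comp_apply (hG₂ _) (hs p),
        fderiv_sqDist_apply, sub_zero]
    rw [e1, e2, fderiv_fun_add ((d3 p).const_mul 2) (hcG hG₁ p), fderiv_const_mul (d2 p),
      fderiv_const_mul (d3 p)]
    simp only [_root_.add_apply, _root_.smul_apply, smul_eq_mul]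
    rw [fderiv_mul_apply hfst d1, fderiv_mul_apply hsnd d1, f1, f1, hfst', hsnd',
      fderiv_comp_apply (hG₁ _) (hs p), fderiv_sqDist_apply]
    have := hode (sqDist 0 p)
    simp only [φ]
    have hsq : sqDist 0 p = p.1 ^ 2 + p.2 ^ 2 := by simp [sqDist]
    have h4 : 4 * (p.1 ^ 2 + p.2 ^ 2) * G₂ (sqDist 0 p) + 8 * G₁ (sqDist 0 p)
      = -μ * G (sqDist 0 p) := by rw [← hsq]; exact this
    linear_combination p.2 * h4
  · rw [hmem] at hp
    exact mul_pos hp.2 (hGpos _ ⟨sqDist_nonneg _ _, hp.1⟩)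
  · rw [hmem, not_and_or, not_lt, not_lt] at hpn
    rcases hpn with h | h
    · have : sqDist 0 p = R₂ ^ 2 := le_antisymm (by simpa [sqDist] using hp) h
      simp [φ, this, hGR]
    · simp [φ, le_antisymm h hp2]
  · rw [hmem] at hp
    have hGp := hGpos _ ⟨sqDist_nonneg 0 p, hp.1⟩
    have hG1 := hG₁neg _ ⟨sqDist_nonneg 0 p, hp.1.le⟩
    have hr0 : 0 ≤ √(sqDist R₁ p) := sqrt_nonneg _
    have hy : p.2 - R₁ ≤ √(sqDist R₁ p) := le_sqrt_of_sq_le (by simp [sqDist]; positivity)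
    have hsq : sqDist 0 p = p.1 ^ 2 + p.2 ^ 2 := by simp [sqDist]
    rw [hφe, hφe]
    set r := √(sqDist R₁ p)
    set s := sqDist 0 p
    have hA : (p.2 - R₁) * G s ≤ 1 / R₁ * r * (p.2 * G s) := by
      rw [← mul_assoc]
      refine mul_le_mul_of_nonneg_right ?_ hGp.le
      rcases le_total p.2 R₁ with h | h
      · exact (sub_nonpos.2 h).trans (mul_nonneg (by positivity) hp.2.le)
      · have : r * R₁ ≤ r * p.2 := mul_le_mul_of_nonneg_left h hr0
        rw [one_div_mul_eq_div, div_mul_eq_mul_div, le_div_iff₀ hR₁]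
        nlinarith
    have hB : (R₁ * p.2 - s) * (-G₁ s) ≤ R₁ * r * (N * G s) := by
      rcases le_total s (R₁ ^ 2) with h | h
      · have h1 := hN s ⟨sqDist_nonneg 0 p, h⟩
        have hcs : R₁ * p.2 - s ≤ R₁ * r := by
          refine le_of_sq_le_sq ?_ (by positivity) |>.trans' (le_refl _)
          rw [mul_pow, sq_sqrt (sqDist_nonneg _ _)]
          simp only [sqDist]
          nlinarith [sq_nonneg p.1, mul_nonneg (sq_nonneg p.1) (sq_nonneg R₁)]
        calc (R₁ * p.2 - s) * (-G₁ s) ≤ R₁ * r * (-G₁ s) :=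
              mul_le_mul_of_nonneg_right hcs (by linarith)
          _ ≤ _ := mul_le_mul_of_nonneg_left h1 (by positivity)
      · have : R₁ * p.2 - s ≤ 0 := by nlinarith [sq_nonneg p.1, sq_nonneg (R₁ - p.2)]
        exact (mul_nonpos_of_nonpos_of_nonneg this (by linarith)).trans (by positivity)
    have hB' := mul_le_mul_of_nonneg_left hB (by linarith [hp.2] : (0 : ℝ) ≤ 2 * p.2)
    simp only [φ]
    calc _ = 2 * p.2 * ((R₁ * p.2 - s) * (-G₁ s)) + (p.2 - R₁) * G s := by
          linear_combination (-2 * p.2 * G₁ s) * hsq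
      _ ≤ 2 * p.2 * (R₁ * r * (N * G s)) + 1 / R₁ * r * (p.2 * G s) := add_le_add hB' hA
      _ = _ := by ring

/-- The logarithmic factor `1 + log (√q / a)`. -/
def logFactor (a q : ℝ) : ℝ := 1 + 1 / 2 * Real.log (q / a ^ 2)

/-- Radial coefficient of the logarithmic Hardy field. -/
def hardyCoeff (A a q : ℝ) : ℝ := 1 / 2 * Real.exp (-A * √q) / (q * logFactor a q)

lemma one_le_logFactor {a q : ℝ} (ha : 0 < a) (hq : a ^ 2 ≤ q) : 1 ≤ logFactor a q := by
  have := Real.log_nonneg ((one_le_div (by positivity : 0 < a ^ 2)).2 hq)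
  unfold logFactor
  linarith

lemma logFactor_mono {a q q' : ℝ} (ha : 0 < a) (hq : 0 < q) (h : q ≤ q') :
    logFactor a q ≤ logFactor a q' := by
  have := Real.log_le_log (by positivity : 0 < q / a ^ 2)
    (div_le_div_of_nonneg_right h (by positivity))
  unfold logFactor
  linarith

lemma hasDerivAt_hardyCoeff {A a q : ℝ} (ha : 0 < a) (hq : a ^ 2 ≤ q) :
    HasDerivAt (hardyCoeff A a)
      (-hardyCoeff A a q * (A / (2 * √q) + 1 / q + 1 / (2 * q * logFactor a q))) q := by
  have hq0 : 0 < q := lt_of_lt_of_le (by positivity) hq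
  have hL := one_le_logFactor ha hq
  have hs : 0 < √q := sqrt_pos.2 hq0
  have h1 : HasDerivAt (fun q => 1 / 2 * Real.exp (-A * √q))
      (1 / 2 * (Real.exp (-A * √q) * (-A * (1 / (2 * √q))))) q :=
    (((hasDerivAt_sqrt hq0.ne').const_mul (-A)).exp).const_mul _
  have h2 : HasDerivAt (logFactor a) (1 / 2 * (1 / a ^ 2 / (q / a ^ 2))) q :=
    ((((hasDerivAt_id q).div_const (a ^ 2)).log
      (div_ne_zero hq0.ne' (by positivity))).const_mul _).const_add 1
  have h3 := (hasDerivAt_id q).mul h2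
  refine (h1.div h3 (by simp; constructor <;> linarith)).congr_deriv ?_
  have hL0 : logFactor a q ≠ 0 := by linarith
  simp only [hardyCoeff, id, Pi.mul_apply]
  field_simp
  ring

lemma contDiff_hardyCoeff_sqDist (A : ℝ) {a : ℝ} (ha : 0 < a) (d : ℝ) :
    ContDiff ℝ (⊤ : ℕ∞) fun p => hardyCoeff A a (sqDist d p + a ^ 2) := by
  have hq : ContDiff ℝ (⊤ : ℕ∞) fun p => sqDist d p + a ^ 2 :=
    (contDiff_sqDist d).add contDiff_const
  have h0 : ∀ p, 0 < sqDist d p + a ^ 2 := fun p => by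
    have := sqDist_nonneg d p
    positivity
  have hL : ∀ p, 1 ≤ logFactor a (sqDist d p + a ^ 2) := fun p =>
    one_le_logFactor ha (by linarith [sqDist_nonneg d p])
  unfold hardyCoeff logFactor at *
  refine ContDiff.div (contDiff_const.mul ?_) (hq.mul ?_) fun p => ?_
  · exact (contDiff_const.mul (hq.sqrt fun p => (h0 p).ne')).exp
  · exact contDiff_const.add (contDiff_const.mul
      ((hq.div_const _).log fun p => (div_pos (h0 p) (by positivity)).ne'))
  · exact (mul_pos (h0 p) (by linarith [hL p])).ne'

lemma hardyCoeff_bound {M a ρ D A q k L : ℝ} (hM : 0 ≤ M) (ha : 0 < a) (ha1 : a ≤ 1)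
    (hρ : 0 ≤ ρ) (hD : 0 ≤ D) (hρD : ρ ≤ D ^ 2) (hAM : A = 4 * M + 2) (hqρ : q = ρ + a ^ 2)
    (hkq : k = hardyCoeff A a q) (hLdef : L = logFactor a q) :
    0 ≤ k ∧ -(1 + M * D) / a ^ 2 ≤
      k * (-2 + 2 * ρ * (A / (2 * √q) + 1 / q + 1 / (2 * q * L)) - ρ * k - 2 * M * √ρ) ∧
      (17 * a ^ 2 ≤ ρ → Real.exp (-A * (D + 1)) / (4 * (D + 1)) / logFactor a (D ^ 2 + 1) ≤
        k * (-2 + 2 * ρ * (A / (2 * √q) + 1 / q + 1 / (2 * q * L)) - ρ * k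
          - 2 * M * √ρ)) := by
  have ha2 : 0 < a ^ 2 := by positivity
  have hq : 0 < q := by rw [hqρ]; positivity
  have hqa : a ^ 2 ≤ q := by linarith
  have hL : 1 ≤ L := hLdef ▸ one_le_logFactor ha hqa
  have hL0 : 0 < L := by linarith
  have hA : 0 < A := by linarith
  obtain ⟨E, hE⟩ : ∃ E, E = Real.exp (-A * √q) := ⟨_, rfl⟩
  have hE1 : E ≤ 1 := by
    rw [hE, Real.exp_le_one_iff]
    linarith [mul_nonneg hA.le (sqrt_nonneg q)]
  have hE0 : 0 < E := hE ▸ Real.exp_pos _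
  have hk : k = 1 / 2 * E / (q * L) := by rw [hkq, hE, hLdef]; rfl
  have hk0 : 0 ≤ k := by rw [hk]; positivity
  have hkle : k ≤ 1 / (2 * q * L) := by
    rw [hk, div_le_div_iff₀ (by positivity) (by positivity)]
    nlinarith [mul_pos hq hL0]
  have hka : k ≤ 1 / (2 * a ^ 2) := by
    refine hkle.trans (one_div_le_one_div_of_le (by positivity) ?_)
    nlinarith
  have hsq : 0 < √q := sqrt_pos.2 hq
  have hρD' : √ρ ≤ D := sqrt_le_iff.2 ⟨hD, hρD⟩
  refine ⟨hk0, ?_, fun h17 => ?_⟩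
  · have h1 : -2 - 2 * M * D ≤ -2 + 2 * ρ * (A / (2 * √q) + 1 / q + 1 / (2 * q * L)) - ρ * k
      - 2 * M * √ρ := by
      have e1 : 0 ≤ 2 * ρ * (A / (2 * √q)) := by positivity
      have e2 : 0 ≤ 2 * ρ * (1 / q) := by positivity
      have e3 : ρ * k ≤ ρ * (1 / (2 * q * L)) := mul_le_mul_of_nonneg_left hkle hρ
      have e4 : 0 ≤ ρ * (1 / (2 * q * L)) := by positivity
      have e5 : M * √ρ ≤ M * D := mul_le_mul_of_nonneg_left hρD' hM
      nlinarith
    calc -(1 + M * D) / a ^ 2 = 1 / (2 * a ^ 2) * (-2 - 2 * M * D) := by field_simp; ring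
      _ ≤ k * (-2 - 2 * M * D) := by
          refine mul_le_mul_of_nonpos_right hka ?_
          nlinarith [mul_nonneg hM hD]
      _ ≤ _ := mul_le_mul_of_nonneg_left h1 hk0
  · have hρ0 : 0 < ρ := by nlinarith
    have hsρ : 0 < √ρ := sqrt_pos.2 hρ0
    have hss : √ρ * √ρ = ρ := mul_self_sqrt hρ
    have hq2 : q ≤ 2 * ρ := by nlinarith
    have hsq2 : √q ≤ 2 * √ρ := by
      rw [sqrt_le_iff]
      exact ⟨by positivity, by nlinarith⟩
    have hT1 : (2 * M + 1) * √ρ ≤ 2 * ρ * (A / (2 * √q)) := by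
      rw [show 2 * ρ * (A / (2 * √q)) = ρ * A / √q by field_simp, le_div_iff₀ hsq]
      calc (2 * M + 1) * √ρ * √q ≤ (2 * M + 1) * √ρ * (2 * √ρ) := by gcongr
        _ = ρ * A := by rw [hAM]; linear_combination (4 * M + 2) * hss
    have hlog : 4 * a ^ 2 * L ≤ ρ := by
      set τ := q / a ^ 2 with hτ
      have hτ0 : 0 < τ := by positivity
      have hτ18 : 18 ≤ τ := by
        rw [hτ, le_div_iff₀ ha2]; linarith
      have hst : 0 < √τ := sqrt_pos.2 hτ0
      have hl : Real.log τ ≤ 2 * (√τ - 1) := by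
        have h1 := Real.log_le_sub_one_of_pos hst
        have h2 : Real.log τ = 2 * Real.log √τ := by rw [Real.log_sqrt hτ0.le]; ring
        linarith
      have hst2 : √τ * √τ = τ := mul_self_sqrt hτ0.le
      have h4 : 4 * √τ ≤ τ - 1 := by
        have : (4.24 : ℝ) ≤ √τ := le_sqrt_of_sq_le (by linarith)
        nlinarith
      have hρτ : ρ = a ^ 2 * (τ - 1) := by
        rw [hτ, hqρ]; field_simp; ring
      rw [hρτ]
      have : 4 * L ≤ τ - 1 := by
        rw [hLdef, logFactor]; linarith
      nlinarith
    have hT2 : 2 ≤ 2 * ρ * (1 / q) + ρ * (1 / (2 * q * L)) := by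
      rw [show 2 * ρ * (1 / q) + ρ * (1 / (2 * q * L)) = (4 * ρ * L + ρ) / (2 * q * L) by
        field_simp; ring, le_div_iff₀ (by positivity)]
      rw [hqρ]
      linarith
    have hT3 : ρ * k ≤ ρ * (1 / (2 * q * L)) := mul_le_mul_of_nonneg_left hkle hρ
    have hbr : √ρ ≤ -2 + 2 * ρ * (A / (2 * √q) + 1 / q + 1 / (2 * q * L)) - ρ * k
      - 2 * M * √ρ := by linarith
    refine le_trans ?_ (mul_le_mul_of_nonneg_left hbr hk0)
    have hqD : q ≤ D ^ 2 + 1 := by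
      have := pow_le_one₀ (n := 2) ha.le ha1
      linarith
    have hLD : L ≤ logFactor a (D ^ 2 + 1) := hLdef ▸ logFactor_mono ha hq hqD
    have hsD : √q ≤ D + 1 := by
      rw [sqrt_le_iff]
      exact ⟨by linarith, by linarith⟩
    have hED : Real.exp (-A * (D + 1)) ≤ E := by
      rw [hE, Real.exp_le_exp]
      linarith [mul_le_mul_of_nonneg_left hsD hA.le]
    calc Real.exp (-A * (D + 1)) / (4 * (D + 1)) / logFactor a (D ^ 2 + 1)
        ≤ E / (4 * (D + 1)) / L := by gcongr
      _ ≤ E / (4 * √ρ) / L := by gcongr; linarith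
      _ = E * √ρ / (4 * ρ * L) := by
          rw [div_div, div_eq_div_iff (by positivity) (by positivity)]
          linear_combination (-4 * E * L) * hss
      _ ≤ E * √ρ / (2 * q * L) := by gcongr E * √ρ / (?_ * L); linarith
      _ = k * √ρ := by rw [hk]; field_simp

lemma field_pointwise_bound {φ k ρ x y fx fy N : ℝ} (hφ : 0 ≤ φ) (hk : 0 ≤ k)
    (hρ : ρ = x ^ 2 + y ^ 2) (hN : fx * x + fy * y ≤ N * √ρ * φ) (v P : ℝ) :
    (φ * v) ^ 2 * (k * (-2 + 2 * ρ * P - ρ * k - 2 * N * √ρ)) ≤ -(φ ^ 2 * v ^ 2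
        * (x * (-k * P * (2 * x * 1 + 2 * y * 0)) + k * 1
          + (y * (-k * P * (2 * x * 0 + 2 * y * 1)) + k * 1)
          + (x * k) ^ 2 + (y * k) ^ 2)
      + 2 * φ * v ^ 2 * (fx * (x * k) + fy * (y * k))) := by
  have h2 := mul_le_mul_of_nonneg_left hN (by positivity : 0 ≤ 2 * φ * v ^ 2 * k)
  have h3 : (φ * v) ^ 2 * (k * (-2 + 2 * ρ * P - ρ * k - 2 * N * √ρ)) =
      φ ^ 2 * v ^ 2 * k * (-2 + 2 * (x ^ 2 + y ^ 2) * P - (x ^ 2 + y ^ 2) * k)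
        - 2 * φ * v ^ 2 * k * (N * √ρ * φ) := by
    rw [← hρ]; ring
  rw [h3]
  linarith

/-- A logarithmic Hardy-type inequality, with an error term supported near `(0, R₁)`. -/
lemma exists_log_hardy {R₁ R₂ : ℝ} {φ : ℝ × ℝ → ℝ} {M : ℝ} (hR₁ : 0 < R₁) (hR₁₂ : R₁ < R₂)
    (hφ : ContDiff ℝ (⊤ : ℕ∞) φ) (hpos : ∀ p ∈ halfDisk R₂, 0 < φ p) (hM : 0 ≤ M)
    (hφM : ∀ p ∈ halfDisk R₂, fderiv ℝ φ p (1, 0) * p.1 + fderiv ℝ φ p (0, 1) * (p.2 - R₁)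
          ≤ M * √(sqDist R₁ p) * φ p) :
    ∃ c C : ℝ, 0 < c ∧ 0 < C ∧ ∀ a, 0 < a → a ≤ 1 → ∀ v, ContDiff ℝ (⊤ : ℕ∞) v →
      HasCompactSupport v → tsupport v ⊆ halfDisk R₂ →
      c / logFactor a ((2 * R₂) ^ 2 + 1) * ∫ p, (φ p * v p) ^ 2 ≤
        (∫ p, φ p ^ 2 * gradSq v p)
          + C / a ^ 2 * ∫ p in {p | sqDist R₁ p < 17 * a ^ 2}, (φ p * v p) ^ 2 := by
  obtain ⟨A, hA⟩ : ∃ A, A = 4 * M + 2 := ⟨_, rfl⟩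
  set D := 2 * R₂ with hDdef
  have hD : 0 ≤ D := by rw [hDdef]; linarith
  set c := Real.exp (-A * (D + 1)) / (4 * (D + 1)) with hc
  have hc0 : 0 < c := by positivity
  refine ⟨c, c + (1 + M * D), hc0, by positivity, fun a ha ha1 v hv hvc hvs => ?_⟩
  set κ := c / logFactor a (D ^ 2 + 1)
  have hΛ : 1 ≤ logFactor a (D ^ 2 + 1) := one_le_logFactor ha (by nlinarith)
  have hκ0 : 0 ≤ κ := by positivity
  have hκc : κ ≤ c := div_le_self hc0.le hΛ
  set K := (c + (1 + M * D)) / a ^ 2 with hK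
  set S : Set (ℝ × ℝ) := {p | sqDist R₁ p < 17 * a ^ 2} with hS
  have hSm : MeasurableSet S :=
    (isOpen_lt (contDiff_sqDist R₁).continuous continuous_const).measurableSet
  have hi : Integrable fun p => (φ p * v p) ^ 2 :=
    ((hφ.continuous.mul hv.continuous).pow 2).integrable_of_hasCompactSupport
      (hvc.of_imp_eq_zero fun p hp => by simp [hp])
  set k : ℝ × ℝ → ℝ := fun p => hardyCoeff A a (sqDist R₁ p + a ^ 2) with hkdef
  have hks : ContDiff ℝ (⊤ : ℕ∞) k := contDiff_hardyCoeff_sqDist A ha R₁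
  have hkd : Differentiable ℝ k := hks.differentiable (by simp)
  have hρd : Differentiable ℝ (sqDist R₁) := (contDiff_sqDist R₁).differentiable (by simp)
  have hs1 : ContDiff ℝ (⊤ : ℕ∞) fun q : ℝ × ℝ => q.1 := contDiff_fst
  have hs2 : ContDiff ℝ (⊤ : ℕ∞) fun q : ℝ × ℝ => q.2 - R₁ := contDiff_snd.sub contDiff_const
  have hi2 : Integrable fun p => K * S.indicator (fun p => (φ p * v p) ^ 2) p :=
    (hi.indicator hSm).const_mul _
  have hWi : Integrable fun p => κ * (φ p * v p) ^ 2
      - K * S.indicator (fun p => (φ p * v p) ^ 2) p := (hi.const_mul _).sub hi2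
  have key := integral_field_le (Y₁ := fun q => q.1 * k q) (Y₂ := fun q => (q.2 - R₁) * k q)
    hφ hv hvc (hs1.mul hks) (hs2.mul hks) hWi ?_ ?_
  · rw [integral_sub (hi.const_mul _) hi2, integral_const_mul, integral_const_mul,
      integral_indicator hSm] at key
    linarith
  · intro p hp
    have hpm : p ∈ halfDisk R₂ := hvs (subset_tsupport _ hp)
    have hφp := hpos p hpm
    have hρ := sqDist_nonneg R₁ p
    have hρD : sqDist R₁ p ≤ D ^ 2 := by
      have h1 : p.1 ^ 2 + p.2 ^ 2 < R₂ ^ 2 := hpm.1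
      have h2 : 0 < p.2 := hpm.2
      simp only [sqDist, hDdef]
      nlinarith
    obtain ⟨hk0, hT, hT'⟩ := hardyCoeff_bound hM ha ha1 hρ hD hρD hA rfl
      (rfl : k p = _) rfl
    have hkder : ∀ e, fderiv ℝ k p e
        = -k p * (A / (2 * √(sqDist R₁ p + a ^ 2)) + 1 / (sqDist R₁ p + a ^ 2)
          + 1 / (2 * (sqDist R₁ p + a ^ 2) * logFactor a (sqDist R₁ p + a ^ 2)))
          * (2 * p.1 * e.1 + 2 * (p.2 - R₁) * e.2) := by
      intro e
      rw [hkdef, fderiv_comp_apply (f := fun q => sqDist R₁ q + a ^ 2)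
        (hasDerivAt_hardyCoeff ha (by linarith)) ((hρd p).add_const _),
        fderiv_add_const, fderiv_sqDist_apply]
    have hY1 : fderiv ℝ (fun q => q.1 * k q) p (1, 0)
        = p.1 * fderiv ℝ k p (1, 0) + k p * 1 := by
      rw [fderiv_mul_apply (hs1.differentiable (by simp)) hkd, hasFDerivAt_fst.fderiv]
      rfl
    have hY2 : fderiv ℝ (fun q => (q.2 - R₁) * k q) p (0, 1)
        = (p.2 - R₁) * fderiv ℝ k p (0, 1) + k p * 1 := by
      rw [fderiv_mul_apply (hs2.differentiable (by simp)) hkd,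
        (hasFDerivAt_snd.sub_const R₁).fderiv]
      rfl
    rw [hY1, hY2, hkder, hkder]
    have hρe : sqDist R₁ p = p.1 ^ 2 + (p.2 - R₁) ^ 2 := rfl
    have h1 := field_pointwise_bound hφp.le hk0 hρe (hφM p hpm) (v p)
      (A / (2 * √(sqDist R₁ p + a ^ 2)) + 1 / (sqDist R₁ p + a ^ 2)
          + 1 / (2 * (sqDist R₁ p + a ^ 2) * logFactor a (sqDist R₁ p + a ^ 2)))
    refine le_trans ?_ h1
    have hφv : 0 ≤ (φ p * v p) ^ 2 := by positivity
    by_cases hpS : p ∈ S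
    · rw [indicator_of_mem hpS]
      have h2 : κ ≤ c / a ^ 2 := hκc.trans ((le_div_iff₀ (by positivity)).2
        (mul_le_of_le_one_right hc0.le (pow_le_one₀ ha.le ha1)))
      have h3 : K = c / a ^ 2 - -(1 + M * D) / a ^ 2 := by rw [hK]; ring
      have h4 := mul_le_mul_of_nonneg_left
        (show κ - K ≤ _ from le_trans (by rw [h3]; linarith) hT) hφv
      linarith
    · rw [indicator_of_notMem hpS]
      have h4 := mul_le_mul_of_nonneg_left (hT' (not_lt.1 hpS)) hφv
      linarith
  · intro p hp
    by_cases hpS : p ∈ S <;> simp [hp, hpS]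

lemma sq_integral_le {g : ℝ → ℝ} (hg : Continuous g) {α β : ℝ} (h : α < β) :
    (∫ y in α..β, g y) ^ 2 ≤ (β - α) * ∫ y in α..β, g y ^ 2 := by
  set J := ∫ y in α..β, g y with hJ
  have h0 : 0 < β - α := sub_pos.2 h
  have h1 : 0 ≤ ∫ y in α..β, ((β - α) * g y - J) ^ 2 :=
    intervalIntegral.integral_nonneg h.le fun y _ => sq_nonneg _
  have i1 : IntervalIntegrable (fun y => (β - α) ^ 2 * g y ^ 2) volume α β :=
    (continuous_const.mul (hg.pow 2)).intervalIntegrable _ _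
  have i2 : IntervalIntegrable (fun y => 2 * (β - α) * J * g y) volume α β :=
    (continuous_const.mul hg).intervalIntegrable _ _
  have i3 : IntervalIntegrable (fun _ : ℝ => J ^ 2) volume α β :=
    continuous_const.intervalIntegrable _ _
  have h2 : ∫ y in α..β, ((β - α) * g y - J) ^ 2 =
      (β - α) ^ 2 * (∫ y in α..β, g y ^ 2) - 2 * (β - α) * J * J + (β - α) * J ^ 2 := by
    rw [← intervalIntegral.integral_const_mul]
    nth_rewrite 2 [hJ]
    rw [← intervalIntegral.integral_const_mul, ← smul_eq_mul (β - α) (J ^ 2),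
      ← intervalIntegral.integral_const, ← intervalIntegral.integral_sub i1 i2,
      ← intervalIntegral.integral_add (i1.sub i2) i3]
    congr 1 with y
    ring
  have h3 : 0 ≤ (β - α) * ((β - α) * (∫ y in α..β, g y ^ 2) - J ^ 2) := by
    rw [h2] at h1
    linarith
  linarith [nonneg_of_mul_nonneg_right h3 h0]

lemma integral_sq_le_of_exists_zero {f f' : ℝ → ℝ} (hf : ∀ y, HasDerivAt f (f' y) y)
    (hf' : Continuous f') {α β t : ℝ} (h : α < β) (ht : t ∈ Icc α β) (h0 : f t = 0) :
    ∫ y in Icc α β, f y ^ 2 ≤ (β - α) ^ 2 * ∫ y in Icc α β, f' y ^ 2 := by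
  rw [integral_Icc_eq_integral_Ioc, integral_Icc_eq_integral_Ioc,
    ← intervalIntegral.integral_of_le h.le, ← intervalIntegral.integral_of_le h.le]
  have hfc : Continuous f := continuous_iff_continuousAt.2 fun y => (hf y).continuousAt
  have key : ∀ y ∈ Icc α β, f y ^ 2 ≤ (β - α) * ∫ y in α..β, f' y ^ 2 := by
    intro y hy
    have h1 : ∫ s in t..y, f' s = f y := by
      rw [intervalIntegral.integral_eq_sub_of_hasDerivAt (fun s _ => hf s)
        (hf'.intervalIntegrable _ _), h0, sub_zero]
    have h2 : |f y| ≤ ∫ s in α..β, |f' s| := by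
      rw [← h1]
      refine (intervalIntegral.norm_integral_le_integral_norm_uIoc (f := f') (μ := volume)).trans ?_
      simp only [Real.norm_eq_abs]
      rw [intervalIntegral.integral_of_le h.le]
      refine setIntegral_mono_set ?_ (Filter.Eventually.of_forall fun _ => abs_nonneg _) ?_
      · exact (hf'.abs.integrableOn_Icc).mono_set Ioc_subset_Icc_self
      · exact (Ioc_subset_Ioc (le_min ht.1 hy.1) (max_le ht.2 hy.2)).eventuallyLE
    calc f y ^ 2 = |f y| ^ 2 := (sq_abs _).symm
      _ ≤ (∫ s in α..β, |f' s|) ^ 2 := by gcongr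
      _ ≤ (β - α) * ∫ s in α..β, |f' s| ^ 2 := sq_integral_le hf'.abs h
      _ = _ := by simp only [sq_abs]
  calc ∫ y in α..β, f y ^ 2 ≤ ∫ _ in α..β, (β - α) * ∫ y in α..β, f' y ^ 2 :=
        intervalIntegral.integral_mono_on h.le ((hfc.pow 2).intervalIntegrable _ _)
          (continuous_const.intervalIntegrable _ _) key
    _ = _ := by rw [intervalIntegral.integral_const, smul_eq_mul]; ring

lemma setIntegral_sq_le_of_exists_zero {v : ℝ × ℝ → ℝ} (hv : ContDiff ℝ 1 v)
    {x₀ x₁ α β : ℝ} (h : α < β) (h0 : ∀ x ∈ Icc x₀ x₁, ∃ t ∈ Icc α β, v (x, t) = 0) :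
    ∫ p in Icc x₀ x₁ ×ˢ Icc α β, v p ^ 2 ≤
      (β - α) ^ 2 * ∫ p in Icc x₀ x₁ ×ˢ Icc α β, gradSq v p := by
  have hd : Continuous fun p => fderiv ℝ v p (0, 1) :=
    (hv.continuous_fderiv one_ne_zero).clm_apply continuous_const
  have hcomp : IsCompact (Icc x₀ x₁ ×ˢ Icc α β) := isCompact_Icc.prod isCompact_Icc
  have i1 : IntegrableOn (fun p => v p ^ 2) (Icc x₀ x₁ ×ˢ Icc α β) :=
    (hv.continuous.pow 2).continuousOn.integrableOn_compact hcomp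
  have i2 : IntegrableOn (fun p => fderiv ℝ v p (0, 1) ^ 2) (Icc x₀ x₁ ×ˢ Icc α β) :=
    (hd.pow 2).continuousOn.integrableOn_compact hcomp
  have i3 : IntegrableOn (gradSq v) (Icc x₀ x₁ ×ˢ Icc α β) :=
    (continuous_gradSq hv).continuousOn.integrableOn_compact hcomp
  have e1 : ∫ p in Icc x₀ x₁ ×ˢ Icc α β, v p ^ 2 =
      ∫ x in Icc x₀ x₁, ∫ y in Icc α β, v (x, y) ^ 2 := setIntegral_prod _ i1
  have e2 : ∫ p in Icc x₀ x₁ ×ˢ Icc α β, fderiv ℝ v p (0, 1) ^ 2 =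
      ∫ x in Icc x₀ x₁, ∫ y in Icc α β, fderiv ℝ v (x, y) (0, 1) ^ 2 := setIntegral_prod _ i2
  calc ∫ p in Icc x₀ x₁ ×ˢ Icc α β, v p ^ 2
      ≤ (β - α) ^ 2 * ∫ p in Icc x₀ x₁ ×ˢ Icc α β, fderiv ℝ v p (0, 1) ^ 2 := by
        rw [e1, e2, ← integral_const_mul]
        refine setIntegral_mono_on ?_ ?_ measurableSet_Icc fun x hx => ?_
        · have := i1
          rw [IntegrableOn, Measure.volume_eq_prod, ← Measure.prod_restrict] at this
          exact this.integral_prod_left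
        · have := i2
          rw [IntegrableOn, Measure.volume_eq_prod, ← Measure.prod_restrict] at this
          exact this.integral_prod_left.const_mul _
        · obtain ⟨t, ht, h0t⟩ := h0 x hx
          refine integral_sq_le_of_exists_zero (f := fun y => v (x, y)) (fun y => ?_)
            (hd.comp (Continuous.prodMk_right x)) h ht h0t
          exact ((hv.differentiable one_ne_zero (x, y)).hasFDerivAt).comp_hasDerivAt y
            ((hasDerivAt_const y x).prodMk (hasDerivAt_id y))
    _ ≤ _ := by
        refine mul_le_mul_of_nonneg_left ?_ (by positivity)
        refine setIntegral_mono_on i2 i3 (measurableSet_Icc.prod measurableSet_Icc) fun p _ => ?_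
        simp only [gradSq]
        linarith [sq_nonneg (fderiv ℝ v p (1, 0))]

/-- Functions vanishing on an arc of length comparable to `a` around `(0, R₁)` satisfy a
Poincaré inequality at scale `a`. -/
lemma exists_local_poincare {R₁ R₂ : ℝ} {φ : ℝ × ℝ → ℝ} (hR₁ : 0 < R₁) (hR₁₂ : R₁ < R₂)
    (hφ : Continuous φ) (hpos : ∀ p ∈ halfDisk R₂, 0 < φ p) :
    ∃ C a₀ : ℝ, 0 < C ∧ 0 < a₀ ∧ ∀ a, 0 < a → a ≤ a₀ → ∀ v, ContDiff ℝ 1 v →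
      HasCompactSupport v → (∀ x, |x| ≤ 5 * a → v (x, √(R₁ ^ 2 - x ^ 2)) = 0) →
      ∫ p in {p | sqDist R₁ p < 17 * a ^ 2}, (φ p * v p) ^ 2 ≤
        C * a ^ 2 * ∫ p, φ p ^ 2 * gradSq v p := by
  obtain ⟨r, hr0, hr1, hr2⟩ : ∃ r, 0 < r ∧ r ≤ R₁ / 2 ∧ r ≤ (R₂ - R₁) / 4 :=
    ⟨min (R₁ / 2) ((R₂ - R₁) / 4), lt_min (by linarith) (by linarith), min_le_left _ _,
      min_le_right _ _⟩
  set Q : ℝ → Set (ℝ × ℝ) := fun r => Icc (-r) r ×ˢ Icc (R₁ - r) (R₁ + r) with hQ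
  have hQc : ∀ r, IsCompact (Q r) := fun r => isCompact_Icc.prod isCompact_Icc
  have hQm : ∀ r, MeasurableSet (Q r) := fun r => measurableSet_Icc.prod measurableSet_Icc
  have hQs : Q r ⊆ halfDisk R₂ := by
    rintro ⟨x, y⟩ ⟨⟨hx1, hx2⟩, hy1, hy2⟩
    simp only at hx1 hx2 hy1 hy2
    refine ⟨?_, ?_⟩
    · change x ^ 2 + y ^ 2 < R₂ ^ 2
      have h1 : x ^ 2 ≤ r ^ 2 := sq_le_sq' hx1 hx2
      have h2 : y ^ 2 ≤ (R₁ + r) ^ 2 := sq_le_sq' (by linarith) hy2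
      nlinarith
    · change 0 < y
      linarith
  have hQn : (Q r).Nonempty := ⟨(0, R₁), ⟨by simp [hr0.le], by simp [hr0.le]⟩⟩
  obtain ⟨p₀, hp₀, hmin⟩ := (hQc r).exists_isMinOn hQn hφ.continuousOn
  obtain ⟨p₁, hp₁, hmax⟩ := (hQc r).exists_isMaxOn hQn hφ.continuousOn
  have hm : 0 < φ p₀ := hpos _ (hQs hp₀)
  have hMx : 0 < φ p₁ := hpos _ (hQs hp₁)
  refine ⟨100 * φ p₁ ^ 2 / φ p₀ ^ 2, r / 5, by positivity, by positivity,
    fun a ha har v hv hvc h0 => ?_⟩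
  have h5 : 5 * a ≤ r := by linarith
  have hQQ : Q (5 * a) ⊆ Q r := prod_mono (Icc_subset_Icc (by linarith) h5)
    (Icc_subset_Icc (by linarith) (by linarith))
  have hS : {p | sqDist R₁ p < 17 * a ^ 2} ⊆ Q (5 * a) := by
    rintro ⟨x, y⟩ hp
    have hp' : x ^ 2 + (y - R₁) ^ 2 < 17 * a ^ 2 := hp
    have hx : |x| ≤ 5 * a := abs_le_of_sq_le_sq (by nlinarith [sq_nonneg (y - R₁)]) (by linarith)
    have hy : |y - R₁| ≤ 5 * a := abs_le_of_sq_le_sq (by nlinarith [sq_nonneg x]) (by linarith)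
    rw [abs_le] at hx hy
    exact ⟨hx, by linarith, by linarith⟩
  have hc1 : Continuous fun p => (φ p * v p) ^ 2 := (hφ.mul hv.continuous).pow 2
  have hc2 : Continuous fun p => φ p ^ 2 * gradSq v p := (hφ.pow 2).mul (continuous_gradSq hv)
  have hi2 : Integrable fun p => φ p ^ 2 * gradSq v p :=
    hc2.integrable_of_hasCompactSupport
      (HasCompactSupport.intro hvc fun p hp => by
        rw [gradSq_eq_zero_of_notMem_tsupport hp, mul_zero])
  have hzero : ∀ x ∈ Icc (-(5 * a)) (5 * a), ∃ t ∈ Icc (R₁ - 5 * a) (R₁ + 5 * a),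
      v (x, t) = 0 := by
    intro x hx
    have hxa : |x| ≤ 5 * a := abs_le.2 hx
    refine ⟨_, ⟨?_, ?_⟩, h0 x hxa⟩
    · have : R₁ - |x| ≤ √(R₁ ^ 2 - x ^ 2) := by
        refine le_sqrt_of_sq_le ?_
        nlinarith [sq_abs x, abs_nonneg x]
      linarith
    · have : √(R₁ ^ 2 - x ^ 2) ≤ R₁ := sqrt_le_iff.2 ⟨hR₁.le, by nlinarith [sq_nonneg x]⟩
      linarith
  calc ∫ p in {p | sqDist R₁ p < 17 * a ^ 2}, (φ p * v p) ^ 2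
      ≤ ∫ p in Q (5 * a), (φ p * v p) ^ 2 :=
        setIntegral_mono_set (hc1.continuousOn.integrableOn_compact (hQc _))
          (Filter.Eventually.of_forall fun _ => sq_nonneg _) hS.eventuallyLE
    _ ≤ ∫ p in Q (5 * a), φ p₁ ^ 2 * v p ^ 2 := by
        refine setIntegral_mono_on (hc1.continuousOn.integrableOn_compact (hQc _))
          ((continuous_const.mul (hv.continuous.pow 2)).continuousOn.integrableOn_compact
            (hQc _)) (hQm _) fun p hp => ?_
        rw [mul_pow]
        have h1 := hmax (hQQ hp)
        have h2 := hpos p (hQs (hQQ hp))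
        simp only [mem_ofPred_eq] at h1
        gcongr
    _ = φ p₁ ^ 2 * ∫ p in Q (5 * a), v p ^ 2 := integral_const_mul _ _
    _ ≤ φ p₁ ^ 2 * ((R₁ + 5 * a - (R₁ - 5 * a)) ^ 2 * ∫ p in Q (5 * a), gradSq v p) := by
        gcongr
        exact setIntegral_sq_le_of_exists_zero hv (by linarith) hzero
    _ = 100 * φ p₁ ^ 2 / φ p₀ ^ 2 * a ^ 2 * ∫ p in Q (5 * a), φ p₀ ^ 2 * gradSq v p := by
        rw [integral_const_mul]
        field_simp
        ring
    _ ≤ 100 * φ p₁ ^ 2 / φ p₀ ^ 2 * a ^ 2 * ∫ p in Q (5 * a), φ p ^ 2 * gradSq v p := by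
        refine mul_le_mul_of_nonneg_left ?_ (by positivity)
        refine setIntegral_mono_on
          ((continuous_const.mul (continuous_gradSq hv)).continuousOn.integrableOn_compact
            (hQc _)) hi2.integrableOn (hQm _) fun p hp => ?_
        have h1 := hmin (hQQ hp)
        simp only [mem_ofPred_eq] at h1
        have := gradSq_nonneg v p
        gcongr
    _ ≤ _ := by
        refine mul_le_mul_of_nonneg_left ?_ (by positivity)
        exact setIntegral_le_integral hi2 (Filter.Eventually.of_forall fun p =>
          mul_nonneg (sq_nonneg _) (gradSq_nonneg v p))

lemma integral_sq_pos {u : ℝ × ℝ → ℝ} (hu : Continuous u) (huc : HasCompactSupport u)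
    (h0 : u ≠ 0) : 0 < ∫ p, u p ^ 2 := by
  obtain ⟨p, hp⟩ := Function.ne_iff.1 h0
  exact (hu.pow 2).integral_pos_of_hasCompactSupport_nonneg_nonzero (x := p)
    (huc.of_imp_eq_zero fun p hp => by simp [hp]) (fun p => sq_nonneg _) (by simpa using hp)

lemma rayleigh_eq {ω : Set (ℝ × ℝ)} {u : ℝ × ℝ → ℝ} (hu : testFun ω u) :
    rayleigh ω u = (∫ p, gradSq u p) / ∫ p, u p ^ 2 := by
  obtain ⟨-, -, hs⟩ := hu
  rw [rayleigh, setIntegral_eq_integral_of_forall_compl_eq_zero,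
    setIntegral_eq_integral_of_forall_compl_eq_zero]
  · intro p hp
    rw [image_eq_zero_of_notMem_tsupport fun h => hp (hs h)]
    simp
  · exact fun p hp => gradSq_eq_zero_of_notMem_tsupport fun h => hp (hs h)

lemma le_lambda1 {ω : Set (ℝ × ℝ)} {m : ℝ} (hne : ∃ u, testFun ω u ∧ u ≠ 0)
    (h : ∀ u, testFun ω u → m * ∫ p, u p ^ 2 ≤ ∫ p, gradSq u p) : m ≤ lambda1 ω := by
  obtain ⟨u, hu, hu0⟩ := hne
  refine le_csInf ⟨_, u, hu, hu0, rfl⟩ ?_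
  rintro r ⟨w, hw, hw0, rfl⟩
  rw [rayleigh_eq hw, le_div_iff₀ (integral_sq_pos hw.1.continuous hw.2.1 hw0)]
  exact h w hw

lemma lambda1_le {ω : Set (ℝ × ℝ)} {u : ℝ × ℝ → ℝ} (hu : testFun ω u) (hu0 : u ≠ 0) :
    lambda1 ω ≤ (∫ p, gradSq u p) / ∫ p, u p ^ 2 := by
  rw [← rayleigh_eq hu]
  refine csInf_le ⟨0, ?_⟩ ⟨u, hu, hu0, rfl⟩
  rintro r ⟨w, hw, -, rfl⟩
  rw [rayleigh_eq hw]
  exact div_nonneg (integral_nonneg fun p => gradSq_nonneg w p)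
    (integral_nonneg fun p => sq_nonneg _)

/-- A test function can be divided by a smooth function which is positive on the domain. -/
lemma exists_testFun_eq_mul {ω : Set (ℝ × ℝ)} {φ u : ℝ × ℝ → ℝ} (hφ : ContDiff ℝ (⊤ : ℕ∞) φ)
    (hpos : ∀ p ∈ ω, 0 < φ p) (hu : testFun ω u) :
    ∃ v, testFun ω v ∧ u = fun p => φ p * v p := by
  obtain ⟨hus, huc, huω⟩ := hu
  have hsupp : tsupport (fun p => u p / φ p) ⊆ tsupport u := by
    refine closure_mono fun p hp => ?_
    simp only [Function.mem_support] at hp ⊢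
    exact fun h => hp (by simp [h])
  refine ⟨fun p => u p / φ p, ⟨?_, huc.of_imp_eq_zero fun p hp => by simp [hp],
    hsupp.trans huω⟩, ?_⟩
  · refine contDiff_iff_contDiffAt.2 fun p => ?_
    by_cases hp : p ∈ tsupport u
    · exact hus.contDiffAt.div hφ.contDiffAt (hpos p (huω hp)).ne'
    · have : (fun p => u p / φ p) =ᶠ[nhds p] fun _ => 0 := by
        filter_upwards [(isClosed_tsupport u).isOpen_compl.mem_nhds hp] with q hq
        rw [image_eq_zero_of_notMem_tsupport hq, zero_div]
      exact contDiffAt_const.congr_of_eventuallyEq this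
  · funext p
    by_cases hp : p ∈ tsupport u
    · have := (hpos p (huω hp)).ne'
      field_simp
    · simp [image_eq_zero_of_notMem_tsupport hp]

lemma mem_crackSetPlus {R₁ δ x : ℝ} (hR₁ : 0 < R₁) (hδ : 0 < δ) (hδ1 : δ ≤ 1)
    (hx : |x| ≤ R₁ * δ / 2) : (x, √(R₁ ^ 2 - x ^ 2)) ∈ crackSetPlus R₁ δ := by
  have hπ := pi_gt_three
  have hπ4 := pi_le_four
  have hsin : δ / 2 ≤ Real.sin δ := by
    refine le_trans ?_ (Real.mul_le_sin hδ.le (by linarith))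
    rw [div_mul_eq_mul_div, div_le_div_iff₀ (by norm_num) pi_pos]
    nlinarith
  have ht : |x / R₁| ≤ Real.sin δ := by
    rw [abs_div, abs_of_pos hR₁, div_le_iff₀ hR₁]
    nlinarith
  rw [abs_le] at ht
  have ht1 : -1 ≤ x / R₁ := by linarith [Real.sin_le_one δ]
  have ht2 : x / R₁ ≤ 1 := by linarith [Real.sin_le_one δ]
  have hasin : Real.arcsin (Real.sin δ) = δ := Real.arcsin_sin (by linarith) (by linarith)
  have h1 : Real.arcsin (x / R₁) ≤ δ := hasin ▸ Real.arcsin_le_arcsin ht.2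
  have h2 : -δ ≤ Real.arcsin (x / R₁) := by
    rw [← hasin, ← Real.arcsin_neg]
    exact Real.arcsin_le_arcsin ht.1
  refine ⟨⟨π / 2 - Real.arcsin (x / R₁), Or.inl ⟨by linarith, by linarith⟩, ?_⟩, ?_⟩
  · rw [Real.cos_pi_div_two_sub, Real.sin_pi_div_two_sub, Real.sin_arcsin ht1 ht2,
      Real.cos_arcsin]
    congr 1
    · field_simp
    · rw [show R₁ ^ 2 - x ^ 2 = R₁ ^ 2 * (1 - (x / R₁) ^ 2) by field_simp,
        Real.sqrt_mul (by positivity), Real.sqrt_sq hR₁.le]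
  · change 0 < √(R₁ ^ 2 - x ^ 2)
    refine Real.sqrt_pos.2 ?_
    have : |x| < R₁ := by nlinarith
    nlinarith [sq_abs x, abs_nonneg x]

lemma logFactor_le {R₁ B δ : ℝ} (hR₁ : 0 < R₁) (hB : 0 < B) (hδ : 0 < δ) (hδ1 : δ ≤ 1 / 4) :
    logFactor (R₁ * δ / 10) B ≤ (2 + 1 / 2 * |Real.log (B / (R₁ / 10) ^ 2)|) * |Real.log δ| := by
  have h1 : Real.log δ ≤ -1 := by
    rw [Real.log_le_iff_le_exp hδ]
    refine hδ1.trans ?_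
    rw [Real.exp_neg, ← one_div]
    exact one_div_le_one_div_of_le (Real.exp_pos 1) (by linarith [Real.exp_one_lt_d9])
  have h2 : logFactor (R₁ * δ / 10) B
      = 1 + 1 / 2 * Real.log (B / (R₁ / 10) ^ 2) - Real.log δ := by
    rw [logFactor, show B / (R₁ * δ / 10) ^ 2 = B / (R₁ / 10) ^ 2 / δ ^ 2 by field_simp,
      Real.log_div (by positivity) (by positivity), Real.log_pow]
    push_cast
    ring
  rw [h2, abs_of_nonpos (by linarith : Real.log δ ≤ 0)]
  nlinarith [le_abs_self (Real.log (B / (R₁ / 10) ^ 2)), abs_nonneg (Real.log (B / (R₁ / 10) ^ 2))]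

lemma mul_integral_sq_le_gradSq {ω : Set (ℝ × ℝ)} {φ u : ℝ × ℝ → ℝ} {μ : ℝ}
    (hφ : ContDiff ℝ (⊤ : ℕ∞) φ)
    (hΔ : ∀ p, fderiv ℝ (fun q => fderiv ℝ φ q (1, 0)) p (1, 0)
      + fderiv ℝ (fun q => fderiv ℝ φ q (0, 1)) p (0, 1) = -μ * φ p)
    (hpos : ∀ p ∈ ω, 0 < φ p) (hu : testFun ω u) :
    μ * ∫ p, u p ^ 2 ≤ ∫ p, gradSq u p := by
  obtain ⟨v, hv, rfl⟩ := exists_testFun_eq_mul hφ hpos hu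
  rw [integral_gradSq_mul hφ hΔ hv.1 hv.2.1]
  have : 0 ≤ ∫ p, φ p ^ 2 * gradSq v p :=
    integral_nonneg fun p => mul_nonneg (sq_nonneg _) (gradSq_nonneg v p)
  linarith

lemma exists_crack_lower_bound {R₁ R₂ : ℝ} {φ : ℝ × ℝ → ℝ} {μ M : ℝ} (hR₁ : 0 < R₁)
    (hR₁₂ : R₁ < R₂) (hφ : ContDiff ℝ (⊤ : ℕ∞) φ)
    (hΔ : ∀ p, fderiv ℝ (fun q => fderiv ℝ φ q (1, 0)) p (1, 0)
      + fderiv ℝ (fun q => fderiv ℝ φ q (0, 1)) p (0, 1) = -μ * φ p)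
    (hpos : ∀ p ∈ halfDisk R₂, 0 < φ p) (hM : 0 ≤ M)
    (hφM : ∀ p ∈ halfDisk R₂, fderiv ℝ φ p (1, 0) * p.1 + fderiv ℝ φ p (0, 1) * (p.2 - R₁)
          ≤ M * √(sqDist R₁ p) * φ p) :
    ∃ c δ₁ : ℝ, 0 < c ∧ 0 < δ₁ ∧ ∀ δ, 0 < δ → δ ≤ δ₁ → ∀ u,
      testFun (halfDisk R₂ \ crackSetPlus R₁ δ) u →
      (μ + c / |Real.log δ|) * ∫ p, u p ^ 2 ≤ ∫ p, gradSq u p := by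
  obtain ⟨c, C, hc, hC, hardy⟩ := exists_log_hardy hR₁ hR₁₂ hφ hpos hM hφM
  obtain ⟨C', a₀, hC', ha₀, poinc⟩ := exists_local_poincare hR₁ hR₁₂ hφ.continuous hpos
  set N := 2 + 1 / 2 * |Real.log (((2 * R₂) ^ 2 + 1) / (R₁ / 10) ^ 2)| with hN
  have hN0 : 0 < N := by positivity
  refine ⟨c / ((1 + C * C') * N), min (1 / 4) (min (10 / R₁) (10 * a₀ / R₁)), by positivity,
    by positivity, fun δ hδ hδ1 u hu => ?_⟩
  have hδ4 : δ ≤ 1 / 4 := hδ1.trans (min_le_left _ _)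
  have hδ5 : δ ≤ 10 / R₁ := hδ1.trans ((min_le_right _ _).trans (min_le_left _ _))
  have hδ6 : δ ≤ 10 * a₀ / R₁ := hδ1.trans ((min_le_right _ _).trans (min_le_right _ _))
  rw [le_div_iff₀ hR₁] at hδ5 hδ6
  set a := R₁ * δ / 10 with ha
  have ha0 : 0 < a := by positivity
  have ha1 : a ≤ 1 := by linarith
  obtain ⟨v, hv, rfl⟩ := exists_testFun_eq_mul hφ (fun p hp => hpos p hp.1) hu
  rw [integral_gradSq_mul hφ hΔ hv.1 hv.2.1]
  have h1 := hardy a ha0 ha1 v hv.1 hv.2.1 (hv.2.2.trans sdiff_subset)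
  have h2 := poinc a ha0 (by linarith) v (hv.1.of_le (by simp)) hv.2.1 fun x hx => by
    by_contra h
    exact (hv.2.2 (subset_tsupport _ h)).2
      (mem_crackSetPlus hR₁ hδ (by linarith) (hx.trans (by linarith)))
  set I := ∫ p, φ p ^ 2 * gradSq v p
  set J := ∫ p, (φ p * v p) ^ 2
  have hJ : 0 ≤ J := integral_nonneg fun p => sq_nonneg _
  set Λ := logFactor a ((2 * R₂) ^ 2 + 1)
  have hΛ1 : 1 ≤ Λ := one_le_logFactor ha0 (by nlinarith)
  have hΛ : Λ ≤ N * |Real.log δ| := logFactor_le hR₁ (by positivity) hδ hδ4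
  have hl : 0 < |Real.log δ| := by
    by_contra! h
    nlinarith
  have h3 : C / a ^ 2 * ∫ p in {p | sqDist R₁ p < 17 * a ^ 2}, (φ p * v p) ^ 2 ≤ C * C' * I := by
    calc _ ≤ C / a ^ 2 * (C' * a ^ 2 * I) := mul_le_mul_of_nonneg_left h2 (by positivity)
      _ = C * C' * I := by field_simp
  have h4 : c / (N * |Real.log δ|) * J ≤ (1 + C * C') * I := by
    calc _ ≤ c / Λ * J := by gcongr
      _ ≤ _ := by linarith
  have h5 : c / ((1 + C * C') * N) / |Real.log δ| * J
      = c / (N * |Real.log δ|) * J / (1 + C * C') := by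
    field_simp
  have h6 : c / ((1 + C * C') * N) / |Real.log δ| * J ≤ I := by
    rw [h5, div_le_iff₀ (by positivity)]
    linarith
  linarith

lemma exists_deriv_smoothTransition_bound :
    ∃ B, 0 ≤ B ∧ ∀ t, |deriv Real.smoothTransition t| ≤ B := by
  have hc : Continuous (deriv Real.smoothTransition) :=
    Real.smoothTransition.contDiff.continuous_deriv (n := 1) le_rfl
  obtain ⟨B, hB⟩ := isCompact_Icc.exists_bound_of_continuousOn (hc.continuousOn (s := Icc 0 1))
  have hB0 : 0 ≤ B := (norm_nonneg _).trans (hB 0 (by simp))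
  refine ⟨B, hB0, fun t => ?_⟩
  by_cases ht : t ∈ Icc 0 1
  · exact hB t ht
  · suffices deriv Real.smoothTransition t = 0 by rw [this, abs_zero]; exact hB0
    rcases lt_or_ge t 0 with h | h
    · have : Real.smoothTransition =ᶠ[nhds t] fun _ => 0 := by
        filter_upwards [Iio_mem_nhds h] with s hs
        exact Real.smoothTransition.zero_of_nonpos (le_of_lt hs)
      rw [this.deriv_eq, deriv_const]
    · have h1 : 1 < t := by
        by_contra! h1
        exact ht ⟨h, h1⟩
      have : Real.smoothTransition =ᶠ[nhds t] fun _ => 1 := by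
        filter_upwards [Ioi_mem_nhds h1] with s hs
        exact Real.smoothTransition.one_of_one_le (le_of_lt hs)
      rw [this.deriv_eq, deriv_const]

lemma hasDerivAt_smoothTransition (t : ℝ) :
    HasDerivAt Real.smoothTransition (deriv Real.smoothTransition t) t :=
  ((Real.smoothTransition.contDiff (n := 1)).differentiable one_ne_zero t).hasDerivAt

lemma isOpen_halfDisk (R : ℝ) : IsOpen (halfDisk R) :=
  (isOpen_lt (by fun_prop) continuous_const).inter (isOpen_lt continuous_const continuous_snd)

/-- Interior cutoff adapted to a function `φ` that is positive in the half-disk and zero on its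
boundary: it equals `1` where `φ ≥ 2 / n` and vanishes where `φ ≤ 1 / n`. -/
def interiorCutoff (R : ℝ) (φ : ℝ × ℝ → ℝ) (n : ℕ) : ℝ × ℝ → ℝ :=
  (halfDisk R).indicator fun p => Real.smoothTransition (n * φ p - 1)

section interiorCutoff

variable {R : ℝ} {φ : ℝ × ℝ → ℝ}

lemma interiorCutoff_mem_Icc (n : ℕ) (p : ℝ × ℝ) : interiorCutoff R φ n p ∈ Icc (0 : ℝ) 1 := by
  by_cases hp : p ∈ halfDisk R
  · rw [interiorCutoff, indicator_of_mem hp]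
    exact ⟨Real.smoothTransition.nonneg _, Real.smoothTransition.le_one _⟩
  · rw [interiorCutoff, indicator_of_notMem hp]
    simp

lemma isCompact_superlevel (hφ : Continuous φ) (R m : ℝ) :
    IsCompact {p : ℝ × ℝ | (p.1 ^ 2 + p.2 ^ 2 ≤ R ^ 2 ∧ 0 ≤ p.2) ∧ m ≤ φ p} := by
  refine (isCompact_closedBall (0 : ℝ × ℝ) |R|).of_isClosed_subset ?_ ?_
  · have hc : Continuous fun p : ℝ × ℝ => p.1 ^ 2 + p.2 ^ 2 := by fun_prop
    exact ((isClosed_le hc continuous_const).inter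
      (isClosed_le continuous_const continuous_snd)).inter (isClosed_le continuous_const hφ)
  · rintro p ⟨⟨h, -⟩, -⟩
    rw [mem_closedBall_zero_iff, Prod.norm_def]
    exact max_le (sq_le_sq.1 (by nlinarith [sq_nonneg p.2]))
      (sq_le_sq.1 (by nlinarith [sq_nonneg p.1]))

lemma interiorCutoff_eq_zero {n : ℕ} (hn : 0 < n) {p : ℝ × ℝ}
    (hp : p ∉ {p : ℝ × ℝ | (p.1 ^ 2 + p.2 ^ 2 ≤ R ^ 2 ∧ 0 ≤ p.2) ∧ 1 / (n : ℝ) ≤ φ p}) :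
    interiorCutoff R φ n p = 0 := by
  by_cases hpR : p ∈ halfDisk R
  · rw [interiorCutoff, indicator_of_mem hpR]
    refine Real.smoothTransition.zero_of_nonpos ?_
    have h1 : φ p < 1 / (n : ℝ) := by
      by_contra! h
      exact hp ⟨⟨le_of_lt hpR.1, le_of_lt hpR.2⟩, h⟩
    rw [lt_div_iff₀ (by positivity)] at h1
    linarith
  · rw [interiorCutoff, indicator_of_notMem hpR]

lemma notMem_superlevel
    (hbd : ∀ p : ℝ × ℝ, p.1 ^ 2 + p.2 ^ 2 ≤ R ^ 2 → 0 ≤ p.2 → p ∉ halfDisk R → φ p = 0)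
    {m : ℝ} (hm : 0 < m) {p : ℝ × ℝ} (hp : p ∉ halfDisk R) :
    p ∉ {p : ℝ × ℝ | (p.1 ^ 2 + p.2 ^ 2 ≤ R ^ 2 ∧ 0 ≤ p.2) ∧ m ≤ φ p} := by
  rintro ⟨⟨h1, h2⟩, h3⟩
  rw [hbd p h1 h2 hp] at h3
  linarith

lemma eventually_interiorCutoff_eq_zero (hφ : ContDiff ℝ (⊤ : ℕ∞) φ)
    (hbd : ∀ p : ℝ × ℝ, p.1 ^ 2 + p.2 ^ 2 ≤ R ^ 2 → 0 ≤ p.2 → p ∉ halfDisk R → φ p = 0)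
    {n : ℕ} (hn : 0 < n) {p : ℝ × ℝ} (hp : p ∉ halfDisk R) :
    interiorCutoff R φ n =ᶠ[nhds p] fun _ => 0 := by
  have := notMem_superlevel hbd (by positivity : (0 : ℝ) < 1 / n) hp
  filter_upwards [(isCompact_superlevel hφ.continuous R _).isClosed.isOpen_compl.mem_nhds this]
    with q hq using interiorCutoff_eq_zero hn hq

lemma eventually_interiorCutoff_eq (n : ℕ) {p : ℝ × ℝ} (hp : p ∈ halfDisk R) :
    interiorCutoff R φ n =ᶠ[nhds p] fun q => Real.smoothTransition (n * φ q - 1) := by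
  filter_upwards [(isOpen_halfDisk R).mem_nhds hp] with q hq
  rw [interiorCutoff, indicator_of_mem hq]

lemma testFun_interiorCutoff (hφ : ContDiff ℝ (⊤ : ℕ∞) φ)
    (hbd : ∀ p : ℝ × ℝ, p.1 ^ 2 + p.2 ^ 2 ≤ R ^ 2 → 0 ≤ p.2 → p ∉ halfDisk R → φ p = 0)
    {n : ℕ} (hn : 0 < n) : testFun (halfDisk R) (interiorCutoff R φ n) := by
  have hK := isCompact_superlevel hφ.continuous R (1 / (n : ℝ))
  refine ⟨contDiff_iff_contDiffAt.2 fun p => ?_,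
    HasCompactSupport.intro hK fun p hp => interiorCutoff_eq_zero hn hp, fun p hp => ?_⟩
  · by_cases hp : p ∈ halfDisk R
    · refine ContDiffAt.congr_of_eventuallyEq ?_ (eventually_interiorCutoff_eq n hp)
      exact (Real.smoothTransition.contDiff.comp
        ((contDiff_const.mul hφ).sub contDiff_const)).contDiffAt
    · exact contDiffAt_const.congr_of_eventuallyEq
        (eventually_interiorCutoff_eq_zero hφ hbd hn hp)
  · by_contra h
    refine notMem_superlevel hbd (by positivity : (0 : ℝ) < 1 / n) h
      (closure_minimal (fun q hq => ?_) hK.isClosed hp)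
    by_contra hq'
    exact hq (interiorCutoff_eq_zero hn hq')

lemma interiorCutoff_eq_one {n : ℕ} {p : ℝ × ℝ} (hp : p ∈ halfDisk R) (h : 2 ≤ n * φ p) :
    interiorCutoff R φ n p = 1 := by
  rw [interiorCutoff, indicator_of_mem hp]
  exact Real.smoothTransition.one_of_one_le (by linarith)

lemma gradSq_congr {f g : ℝ × ℝ → ℝ} {p : ℝ × ℝ} (h : f =ᶠ[nhds p] g) :
    gradSq f p = gradSq g p := by
  rw [gradSq, gradSq, h.fderiv_eq]

lemma gradSq_const (c : ℝ) (p : ℝ × ℝ) : gradSq (fun _ => c) p = 0 := by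
  simp [gradSq]

lemma gradSq_comp {g : ℝ → ℝ} {g' : ℝ} {f : ℝ × ℝ → ℝ} {p : ℝ × ℝ}
    (hg : HasDerivAt g g' (f p)) (hf : DifferentiableAt ℝ f p) :
    gradSq (fun q => g (f q)) p = g' ^ 2 * gradSq f p := by
  simp only [gradSq, fderiv_comp_apply hg hf]
  ring

lemma gradSq_interiorCutoff_eq_zero (hφ : ContDiff ℝ (⊤ : ℕ∞) φ) {n : ℕ} {p : ℝ × ℝ}
    (hp : p ∈ halfDisk R) (h : 2 < n * φ p) : gradSq (interiorCutoff R φ n) p = 0 := by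
  rw [← gradSq_const 1 p]
  refine gradSq_congr ?_
  have h1 : ∀ᶠ q in nhds p, 2 < n * φ q :=
    (continuous_const.mul hφ.continuous).continuousAt.eventually (Ioi_mem_nhds h)
  filter_upwards [h1, (isOpen_halfDisk R).mem_nhds hp] with q hq hqR
  exact interiorCutoff_eq_one hqR hq.le

lemma sq_mul_gradSq_interiorCutoff_le (hφ : ContDiff ℝ (⊤ : ℕ∞) φ) {B : ℝ}
    (hB : ∀ t, |deriv Real.smoothTransition t| ≤ B) (n : ℕ) {p : ℝ × ℝ}
    (hp : p ∈ halfDisk R) (hφp : 0 < φ p) :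
    φ p ^ 2 * gradSq (interiorCutoff R φ n) p ≤ 4 * B ^ 2 * gradSq φ p := by
  have h0 := gradSq_nonneg φ p
  rcases lt_or_ge 2 (n * φ p) with h | h
  · rw [gradSq_interiorCutoff_eq_zero hφ hp h, mul_zero]
    positivity
  · have hφd : DifferentiableAt ℝ φ p := hφ.differentiable (by simp) p
    have h2 : HasDerivAt (fun t => Real.smoothTransition (n * t - 1))
        (deriv Real.smoothTransition (n * φ p - 1) * (n * 1)) (φ p) :=
      HasDerivAt.comp (h := fun t : ℝ => n * t - 1) (φ p)
        (hasDerivAt_smoothTransition (n * φ p - 1))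
        (((hasDerivAt_id' (φ p)).const_mul (n : ℝ)).sub_const 1)
    rw [gradSq_congr (eventually_interiorCutoff_eq n hp), gradSq_comp h2 hφd]
    have h3 : deriv Real.smoothTransition (n * φ p - 1) ^ 2 ≤ B ^ 2 :=
      sq_le_sq.2 ((hB _).trans (le_abs_self B))
    have h4 : (n * φ p) ^ 2 ≤ 2 ^ 2 := by gcongr
    calc φ p ^ 2 * ((deriv Real.smoothTransition (n * φ p - 1) * (n * 1)) ^ 2 * gradSq φ p)
        = (n * φ p) ^ 2 * deriv Real.smoothTransition (n * φ p - 1) ^ 2 * gradSq φ p := by ring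
      _ ≤ 2 ^ 2 * B ^ 2 * gradSq φ p := by gcongr
      _ = _ := by ring

lemma tendsto_integral_interiorCutoff (hφ : ContDiff ℝ (⊤ : ℕ∞) φ)
    (hpos : ∀ p ∈ halfDisk R, 0 < φ p)
    (hbd : ∀ p : ℝ × ℝ, p.1 ^ 2 + p.2 ^ 2 ≤ R ^ 2 → 0 ≤ p.2 → p ∉ halfDisk R → φ p = 0) :
    Filter.Tendsto (fun n : ℕ => ∫ p, φ p ^ 2 * gradSq (interiorCutoff R φ n) p)
      Filter.atTop (nhds 0) := by
  obtain ⟨B, hB0, hB⟩ := exists_deriv_smoothTransition_bound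
  have hbound : Integrable ((halfDisk R).indicator fun p => 4 * B ^ 2 * gradSq φ p) := by
    refine IntegrableOn.integrable_indicator ?_ (isOpen_halfDisk R).measurableSet
    have hc : Continuous fun p => 4 * B ^ 2 * gradSq φ p :=
      continuous_const.mul (continuous_gradSq (hφ.of_le (by simp)))
    refine (hc.continuousOn.integrableOn_compact
      (isCompact_superlevel (φ := fun _ => 0) continuous_const R 0)).mono_set fun p hp => ?_
    exact ⟨⟨le_of_lt hp.1, le_of_lt hp.2⟩, le_rfl⟩
  rw [← integral_zero (ℝ × ℝ) ℝ (μ := volume)]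
  have hout : ∀ n : ℕ, 0 < n → ∀ p ∉ halfDisk R, gradSq (interiorCutoff R φ n) p = 0 :=
    fun n hn p hp => by
      rw [gradSq_congr (eventually_interiorCutoff_eq_zero hφ hbd hn hp), gradSq_const]
  refine tendsto_integral_filter_of_dominated_convergence _ ?_ ?_ hbound ?_
  · filter_upwards [Filter.eventually_gt_atTop 0] with n hn
    exact ((hφ.continuous.pow 2).mul (continuous_gradSq
      ((testFun_interiorCutoff hφ hbd hn).1.of_le (by simp)))).aestronglyMeasurable
  · filter_upwards [Filter.eventually_gt_atTop 0] with n hn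
    refine Filter.Eventually.of_forall fun p => ?_
    rw [Real.norm_of_nonneg (mul_nonneg (sq_nonneg _) (gradSq_nonneg _ p))]
    by_cases hp : p ∈ halfDisk R
    · rw [indicator_of_mem hp]
      exact sq_mul_gradSq_interiorCutoff_le hφ hB n hp (hpos p hp)
    · rw [indicator_of_notMem hp, hout n hn p hp, mul_zero]
  · refine Filter.Eventually.of_forall fun p => tendsto_const_nhds.congr' ?_
    by_cases hp : p ∈ halfDisk R
    · have := hpos p hp
      filter_upwards [(tendsto_natCast_atTop_atTop (R := ℝ)).eventually_gt_atTop (2 / φ p)]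
        with n hn
      rw [gradSq_interiorCutoff_eq_zero hφ hp, mul_zero]
      rwa [div_lt_iff₀ this] at hn
    · filter_upwards [Filter.eventually_gt_atTop 0] with n hn
      rw [hout n hn p hp, mul_zero]

end interiorCutoff

lemma gradSq_mul_le {χ η : ℝ × ℝ → ℝ} (hχ : Differentiable ℝ χ) (hη : Differentiable ℝ η)
    {p : ℝ × ℝ} (h1 : |χ p| ≤ 1) (h2 : |η p| ≤ 1) :
    gradSq (fun q => χ q * η q) p ≤ 2 * gradSq η p + 2 * gradSq χ p := by
  have hb : ∀ s t x y : ℝ, |s| ≤ 1 → |t| ≤ 1 →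
      (s * x + t * y) ^ 2 ≤ 2 * x ^ 2 + 2 * y ^ 2 := by
    intro s t x y hs ht
    have hs2 := (sq_le_one_iff_abs_le_one s).2 hs
    have ht2 := (sq_le_one_iff_abs_le_one t).2 ht
    nlinarith [sq_nonneg (s * x - t * y), mul_le_mul_of_nonneg_right hs2 (sq_nonneg x),
      mul_le_mul_of_nonneg_right ht2 (sq_nonneg y)]
  simp only [gradSq, fderiv_mul_apply hχ hη]
  have e1 := hb (χ p) (η p) (fderiv ℝ η p (1, 0)) (fderiv ℝ χ p (1, 0)) h1 h2
  have e2 := hb (χ p) (η p) (fderiv ℝ η p (0, 1)) (fderiv ℝ χ p (0, 1)) h1 h2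
  linarith

/-- Bounding the first eigenvalue of a perforated half-disk from above by a capacity. -/
lemma lambda1_halfDisk_sdiff_le {R : ℝ} {φ : ℝ × ℝ → ℝ} {μ : ℝ} (hφ : ContDiff ℝ (⊤ : ℕ∞) φ)
    (hΔ : ∀ p, fderiv ℝ (fun q => fderiv ℝ φ q (1, 0)) p (1, 0)
      + fderiv ℝ (fun q => fderiv ℝ φ q (0, 1)) p (0, 1) = -μ * φ p)
    (hpos : ∀ p ∈ halfDisk R, 0 < φ p)
    (hbd : ∀ p : ℝ × ℝ, p.1 ^ 2 + p.2 ^ 2 ≤ R ^ 2 → 0 ≤ p.2 → p ∉ halfDisk R → φ p = 0)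
    {B : Set (ℝ × ℝ)} (hBc : IsCompact B) (hB : B ⊆ halfDisk R) (hB0 : 0 < volume.real B) :
    ∃ c, 0 < c ∧ ∀ (K : Set (ℝ × ℝ)) (η : ℝ × ℝ → ℝ), ContDiff ℝ (⊤ : ℕ∞) η →
      (∀ p, |η p| ≤ 1) → (∀ p ∈ B, η p = 1) → (∀ p ∈ K, p ∉ tsupport η) →
      (∃ u, testFun (halfDisk R \ K) u ∧ u ≠ 0) ∧
      lambda1 (halfDisk R \ K) ≤ μ + c * ∫ p in halfDisk R, φ p ^ 2 * gradSq η p := by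
  have hBn : B.Nonempty := by
    by_contra h
    rw [not_nonempty_iff_eq_empty.1 h] at hB0
    simp at hB0
  obtain ⟨p₀, hp₀, hmin⟩ := hBc.exists_isMinOn hBn hφ.continuous.continuousOn
  set m := φ p₀ with hm
  have hm0 : 0 < m := hpos _ (hB hp₀)
  have hmB : ∀ p ∈ B, m ≤ φ p := fun p hp => hmin hp
  have hBfin : volume B ≠ ⊤ := hBc.measure_lt_top.ne
  set J := m ^ 2 * volume.real B with hJ
  have hJ0 : 0 < J := by positivity
  refine ⟨2 / J, by positivity, fun K η hη hη1 hηB hηK => ?_⟩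
  have hηd : Differentiable ℝ η := hη.differentiable (by simp)
  set I := ∫ p in halfDisk R, φ p ^ 2 * gradSq η p with hI
  set e : ℕ → ℝ := fun n => ∫ p, φ p ^ 2 * gradSq (interiorCutoff R φ n) p with he
  have hcη : Continuous fun p => φ p ^ 2 * gradSq η p :=
    (hφ.continuous.pow 2).mul (continuous_gradSq (hη.of_le (by simp)))
  have hiη : IntegrableOn (fun p => φ p ^ 2 * gradSq η p) (halfDisk R) :=
    (hcη.continuousOn.integrableOn_compact
      (isCompact_superlevel (φ := fun _ => 0) continuous_const R 0)).mono_set fun p hp =>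
        ⟨⟨le_of_lt hp.1, le_of_lt hp.2⟩, le_rfl⟩
  have main : ∀ᶠ n : ℕ in Filter.atTop, ∃ u, testFun (halfDisk R \ K) u ∧ u ≠ 0 ∧
      lambda1 (halfDisk R \ K) ≤ μ + (2 * I + 2 * e n) / J := by
    filter_upwards [Filter.eventually_gt_atTop 0,
      (tendsto_natCast_atTop_atTop (R := ℝ)).eventually_ge_atTop (2 / m)] with n hn hnm
    rw [div_le_iff₀ hm0] at hnm
    set χ := interiorCutoff R φ n with hχdef
    obtain ⟨hχ, hχc, hχs⟩ := testFun_interiorCutoff hφ hbd hn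
    have hχd : Differentiable ℝ χ := hχ.differentiable (by simp)
    have hχ1 : ∀ p, |χ p| ≤ 1 := fun p =>
      abs_le.2 ⟨by linarith [(interiorCutoff_mem_Icc (R := R) (φ := φ) n p).1],
        (interiorCutoff_mem_Icc n p).2⟩
    set v : ℝ × ℝ → ℝ := fun p => χ p * η p with hv
    have hvs : ContDiff ℝ (⊤ : ℕ∞) v := hχ.mul hη
    have hvc : HasCompactSupport v := hχc.of_imp_eq_zero fun p hp =>
      mul_eq_zero_of_left hp _
    set u : ℝ × ℝ → ℝ := fun p => φ p * v p with hu
    have hut : tsupport u ⊆ tsupport χ ∩ tsupport η := by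
      refine subset_inter (closure_mono fun p hp => ?_) (closure_mono fun p hp => ?_) <;>
      · rw [Function.mem_support] at hp ⊢
        contrapose! hp
        simp [hu, hv, hp]
    have huB : ∀ p ∈ B, m ≤ u p := by
      intro p hp
      have h1 : χ p = 1 := interiorCutoff_eq_one (hB hp)
        (hnm.trans (mul_le_mul_of_nonneg_left (hmB p hp) (by positivity)))
      simp only [hu, hv]
      rw [h1, hηB p hp, mul_one, mul_one]
      exact hmB p hp
    have huc : HasCompactSupport u := hvc.of_imp_eq_zero fun p hp => by simp [hu, hp]
    have hus : ContDiff ℝ (⊤ : ℕ∞) u := hφ.mul hvs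
    have htest : testFun (halfDisk R \ K) u :=
      ⟨hus, huc, fun p hp => ⟨hχs (hut hp).1, fun hK => hηK p hK (hut hp).2⟩⟩
    have hu0 : u ≠ 0 := by
      intro h
      have := huB p₀ hp₀
      rw [h, Pi.zero_apply] at this
      linarith
    refine ⟨u, htest, hu0, (lambda1_le htest hu0).trans ?_⟩
    have hiu : Integrable fun p => u p ^ 2 :=
      (hus.continuous.pow 2).integrable_of_hasCompactSupport
        (huc.of_imp_eq_zero fun p hp => by simp [hp])
    have hJu : J ≤ ∫ p, u p ^ 2 := by
      calc J = ∫ _ in B, m ^ 2 := by rw [setIntegral_const, smul_eq_mul, mul_comm]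
        _ ≤ ∫ p in B, u p ^ 2 :=
          setIntegral_mono_on (integrableOn_const hBfin) hiu.integrableOn hBc.measurableSet
            fun p hp => by
              have := huB p hp
              gcongr
        _ ≤ _ := setIntegral_le_integral hiu (Filter.Eventually.of_forall fun p => sq_nonneg _)
    have hiχ : Integrable fun p => φ p ^ 2 * gradSq χ p :=
      ((hφ.continuous.pow 2).mul (continuous_gradSq (hχ.of_le (by simp))))
        |>.integrable_of_hasCompactSupport (HasCompactSupport.intro hχc fun p hp =>
          mul_eq_zero_of_right _ (gradSq_eq_zero_of_notMem_tsupport hp))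
    have hiv : Integrable fun p => φ p ^ 2 * gradSq v p :=
      ((hφ.continuous.pow 2).mul (continuous_gradSq (hvs.of_le (by simp))))
        |>.integrable_of_hasCompactSupport (HasCompactSupport.intro hvc fun p hp =>
          mul_eq_zero_of_right _ (gradSq_eq_zero_of_notMem_tsupport hp))
    have hvle : ∫ p, φ p ^ 2 * gradSq v p ≤ 2 * I + 2 * e n := by
      have i1 : Integrable fun p =>
          2 * (halfDisk R).indicator (fun p => φ p ^ 2 * gradSq η p) p :=
        (hiη.integrable_indicator (isOpen_halfDisk R).measurableSet).const_mul 2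
      have i2 : Integrable fun p => 2 * (φ p ^ 2 * gradSq χ p) := hiχ.const_mul 2
      have e1 : 2 * I + 2 * e n = ∫ p,
          (2 * (halfDisk R).indicator (fun p => φ p ^ 2 * gradSq η p) p
            + 2 * (φ p ^ 2 * gradSq χ p)) := by
        rw [integral_add i1 i2, integral_const_mul, integral_const_mul,
          integral_indicator (isOpen_halfDisk R).measurableSet]
      rw [e1]
      refine integral_mono hiv (i1.add i2) fun p => ?_
      by_cases hp : p ∈ halfDisk R
      · simp only [indicator_of_mem hp]
        have h1 := mul_le_mul_of_nonneg_left (gradSq_mul_le hχd hηd (hχ1 p) (hη1 p))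
          (sq_nonneg (φ p))
        linarith
      · simp only [indicator_of_notMem hp]
        have h1 : gradSq v p = 0 := gradSq_eq_zero_of_notMem_tsupport fun h => hp
          (hχs (closure_mono (fun q hq => by
            rw [Function.mem_support] at hq ⊢
            contrapose! hq
            exact mul_eq_zero_of_left hq _) h))
        have h2 := mul_nonneg (sq_nonneg (φ p)) (gradSq_nonneg χ p)
        rw [h1]
        linarith
    have hvnn : 0 ≤ ∫ p, φ p ^ 2 * gradSq v p :=
      integral_nonneg fun p => mul_nonneg (sq_nonneg _) (gradSq_nonneg v p)
    have hu2 : 0 < ∫ p, u p ^ 2 := hJ0.trans_le hJu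
    rw [integral_gradSq_mul hφ hΔ hvs hvc, add_div, mul_div_cancel_right₀ _ hu2.ne']
    gcongr
    exact hvnn.trans hvle
  refine ⟨?_, ?_⟩
  · obtain ⟨n, u, hu, hu0, -⟩ := main.exists
    exact ⟨u, hu, hu0⟩
  · have hlim : Filter.Tendsto (fun n => μ + (2 * I + 2 * e n) / J) Filter.atTop
        (nhds (μ + (2 * I + 2 * 0) / J)) :=
      (((tendsto_integral_interiorCutoff hφ hpos hbd).const_mul 2).const_add _ |>.div_const J)
        |>.const_add μ
    refine (ge_of_tendsto hlim (main.mono fun n ⟨_, _, _, h⟩ => h)).trans (le_of_eq ?_)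
    ring

lemma gradSq_sqDist (d : ℝ) (p : ℝ × ℝ) : gradSq (sqDist d) p = 4 * sqDist d p := by
  simp only [gradSq, fderiv_sqDist_apply, sqDist]
  ring

lemma integral_inv_norm_sq_add {a D : ℝ} (ha : 0 < a) (hD : 0 ≤ D) :
    ∫ p : ℝ × ℝ in Metric.closedBall 0 D, 1 / (‖p‖ ^ 2 + a ^ 2)
      = 4 * Real.log ((D ^ 2 + a ^ 2) / a ^ 2) := by
  have h1 : ∫ p : ℝ × ℝ in Metric.closedBall 0 D, 1 / (‖p‖ ^ 2 + a ^ 2)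
      = ∫ p : ℝ × ℝ, (Iic D).indicator (fun y => 1 / (y ^ 2 + a ^ 2)) ‖p‖ := by
    rw [← integral_indicator Metric.isClosed_closedBall.measurableSet]
    congr 1 with p
    by_cases hp : ‖p‖ ≤ D
    · rw [indicator_of_mem (by simpa using hp), indicator_of_mem (by simpa using hp)]
    · rw [indicator_of_notMem (by simpa using hp), indicator_of_notMem (by simpa using hp)]
  have hvol : volume.real (Metric.ball (0 : ℝ × ℝ) 1) = 4 := by
    rw [show (0 : ℝ × ℝ) = (0, 0) from rfl, ← ball_prod_same, Measure.volume_eq_prod,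
      measureReal_prod_prod, measureReal_def, Real.volume_ball]
    norm_num
  have h2 : ∫ y in Ioi (0 : ℝ), y ^ (2 - 1) • (Iic D).indicator (fun y => 1 / (y ^ 2 + a ^ 2)) y
      = ∫ y in (0 : ℝ)..D, y / (y ^ 2 + a ^ 2) := by
    rw [intervalIntegral.integral_of_le hD, ← Ioi_inter_Iic,
      ← setIntegral_indicator measurableSet_Iic]
    congr 1 with y
    by_cases hy : y ∈ Iic D
    · rw [indicator_of_mem hy, indicator_of_mem hy]
      simp [div_eq_mul_inv]
    · rw [indicator_of_notMem hy, indicator_of_notMem hy, smul_zero]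
  have h0 : ∀ y : ℝ, 0 < y ^ 2 + a ^ 2 := fun y => by positivity
  have h3 : ∫ y in (0 : ℝ)..D, y / (y ^ 2 + a ^ 2)
      = 1 / 2 * Real.log (D ^ 2 + a ^ 2) - 1 / 2 * Real.log (0 ^ 2 + a ^ 2) := by
    refine intervalIntegral.integral_eq_sub_of_hasDerivAt
      (f := fun y => 1 / 2 * Real.log (y ^ 2 + a ^ 2)) (fun y _ => ?_) ?_
    · refine ((((hasDerivAt_pow 2 y).add_const (a ^ 2)).log (h0 y).ne').const_mul
        (1 / 2 : ℝ)).congr_deriv ?_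
      have := (h0 y).ne'
      field_simp
      ring
    · exact (continuous_id.div (by fun_prop) fun y => (h0 y).ne').intervalIntegrable _ _
  have hdim : Module.finrank ℝ (ℝ × ℝ) = 2 := by simp
  rw [h1, integral_fun_norm_addHaar, hdim, hvol, h2, h3,
    Real.log_div (h0 D).ne' (by positivity)]
  simp only [nsmul_eq_mul, smul_eq_mul]
  norm_num
  ring

lemma setIntegral_inv_sqDist_le {R₁ R₂ a : ℝ} (hR₁ : 0 < R₁) (hR₁₂ : R₁ < R₂) (ha : 0 < a) :
    ∫ p in halfDisk R₂, 1 / (sqDist R₁ p + a ^ 2)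
      ≤ 4 * Real.log (((2 * R₂) ^ 2 + a ^ 2) / a ^ 2) := by
  have hR₂ : 0 < R₂ := hR₁.trans hR₁₂
  have h0 : ∀ p : ℝ × ℝ, 0 < ‖p‖ ^ 2 + a ^ 2 := fun p => by positivity
  rw [← integral_inv_norm_sq_add ha (by linarith),
    ← integral_indicator Metric.isClosed_closedBall.measurableSet,
    ← integral_indicator (isOpen_halfDisk R₂).measurableSet,
    ← integral_sub_right_eq_self
      (indicator (Metric.closedBall (0 : ℝ × ℝ) (2 * R₂)) _) ((0, R₁) : ℝ × ℝ)]
  have hi : Integrable ((Metric.closedBall (0 : ℝ × ℝ) (2 * R₂)).indicator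
      fun p => 1 / (‖p‖ ^ 2 + a ^ 2)) := by
    refine IntegrableOn.integrable_indicator ?_ Metric.isClosed_closedBall.measurableSet
    refine ContinuousOn.integrableOn_compact (isCompact_closedBall _ _) ?_
    exact (continuous_const.div (by fun_prop) fun p => (h0 p).ne').continuousOn
  refine integral_mono_of_nonneg (Filter.Eventually.of_forall fun p => ?_)
    (hi.comp_sub_right _) (Filter.Eventually.of_forall fun p => ?_)
  · refine indicator_nonneg (fun q _ => ?_) p
    have := sqDist_nonneg R₁ q
    positivity
  · by_cases hp : p ∈ halfDisk R₂
    · have hp1 := hp.1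
      have hp2 := hp.2
      change p.1 ^ 2 + p.2 ^ 2 < R₂ ^ 2 at hp1
      change 0 < p.2 at hp2
      have hx : |p.1| < R₂ := abs_lt_of_sq_lt_sq (by nlinarith) hR₂.le
      have hy : |p.2| < R₂ := abs_lt_of_sq_lt_sq (by nlinarith) hR₂.le
      rw [abs_lt] at hx hy
      have hn : ‖p - (0, R₁)‖ = max |p.1| |p.2 - R₁| := by
        simp [Prod.norm_def]
      have hmem : p - (0, R₁) ∈ Metric.closedBall (0 : ℝ × ℝ) (2 * R₂) := by
        rw [mem_closedBall_zero_iff, hn]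
        refine max_le (abs_le.2 ⟨?_, ?_⟩) (abs_le.2 ⟨?_, ?_⟩) <;> linarith
      have hle : ‖p - (0, R₁)‖ ^ 2 ≤ sqDist R₁ p := by
        rw [hn, sqDist]
        rcases max_choice |p.1| |p.2 - R₁| with h | h <;> rw [h, sq_abs] <;>
          nlinarith [sq_nonneg p.1, sq_nonneg (p.2 - R₁)]
      beta_reduce
      rw [indicator_of_mem hp, indicator_of_mem hmem]
      exact one_div_le_one_div_of_le (h0 _) (by linarith)
    · rw [indicator_of_notMem hp]
      exact indicator_nonneg (fun q _ => by positivity) _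

/-- Logarithmic cutoff vanishing near `{sqDist R₁ ≤ a²}`. -/
def logCutoff (R₁ a l : ℝ) (p : ℝ × ℝ) : ℝ :=
  Real.smoothTransition (Real.log ((sqDist R₁ p + a ^ 2) / (4 * a ^ 2)) / l)

section logCutoff

variable {R₁ a l : ℝ}

lemma contDiff_logCutoff (ha : 0 < a) : ContDiff ℝ (⊤ : ℕ∞) (logCutoff R₁ a l) := by
  have h0 : ∀ p, (sqDist R₁ p + a ^ 2) / (4 * a ^ 2) ≠ 0 := fun p => by
    have := sqDist_nonneg R₁ p
    positivity
  exact Real.smoothTransition.contDiff.comp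
    (((((contDiff_sqDist R₁).add contDiff_const).div_const _).log h0).div_const l)

lemma abs_logCutoff_le (p : ℝ × ℝ) : |logCutoff R₁ a l p| ≤ 1 := by
  rw [logCutoff, abs_of_nonneg (Real.smoothTransition.nonneg _)]
  exact Real.smoothTransition.le_one _

lemma logCutoff_eq_one (ha : 0 < a) (hl : 0 < l) {p : ℝ × ℝ}
    (h : 4 * a ^ 2 * Real.exp l ≤ sqDist R₁ p) : logCutoff R₁ a l p = 1 := by
  refine Real.smoothTransition.one_of_one_le ?_
  have := sqDist_nonneg R₁ p
  rw [le_div_iff₀ hl, one_mul, Real.le_log_iff_exp_le (by positivity),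
    le_div_iff₀ (by positivity)]
  nlinarith

lemma notMem_tsupport_logCutoff (ha : 0 < a) (hl : 0 < l) {p : ℝ × ℝ}
    (h : sqDist R₁ p ≤ a ^ 2) : p ∉ tsupport (logCutoff R₁ a l) := by
  have hcl : IsClosed {p | 3 * a ^ 2 ≤ sqDist R₁ p} :=
    isClosed_le continuous_const (contDiff_sqDist R₁).continuous
  intro hp
  have h3 : 3 * a ^ 2 ≤ sqDist R₁ p := by
    refine closure_minimal (fun q hq => ?_) hcl hp
    by_contra h
    refine hq (Real.smoothTransition.zero_of_nonpos ?_)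
    have h1 : sqDist R₁ q < 3 * a ^ 2 := not_le.1 h
    have := sqDist_nonneg R₁ q
    refine div_nonpos_of_nonpos_of_nonneg (Real.log_nonpos (by positivity) ?_) hl.le
    rw [div_le_one (by positivity)]
    linarith
  nlinarith [pow_pos ha 2]

lemma gradSq_logCutoff_le (ha : 0 < a) (hl : 0 < l) {B : ℝ}
    (hB : ∀ t, |deriv Real.smoothTransition t| ≤ B) (p : ℝ × ℝ) :
    gradSq (logCutoff R₁ a l) p ≤ 4 * B ^ 2 / l ^ 2 * (1 / (sqDist R₁ p + a ^ 2)) := by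
  have hρ := sqDist_nonneg R₁ p
  have hq : 0 < sqDist R₁ p + a ^ 2 := by positivity
  set t := Real.log ((sqDist R₁ p + a ^ 2) / (4 * a ^ 2)) / l with ht
  have h1 : HasDerivAt (fun r => Real.log ((r + a ^ 2) / (4 * a ^ 2)) / l)
      (1 / (4 * a ^ 2) / ((sqDist R₁ p + a ^ 2) / (4 * a ^ 2)) / l) (sqDist R₁ p) :=
    ((((hasDerivAt_id' (sqDist R₁ p)).add_const (a ^ 2)).div_const (4 * a ^ 2)).log
      (by positivity)).div_const l
  have h2 : HasDerivAt
      (fun r => Real.smoothTransition (Real.log ((r + a ^ 2) / (4 * a ^ 2)) / l))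
      (deriv Real.smoothTransition t *
        (1 / (4 * a ^ 2) / ((sqDist R₁ p + a ^ 2) / (4 * a ^ 2)) / l)) (sqDist R₁ p) :=
    HasDerivAt.comp (h := fun r => Real.log ((r + a ^ 2) / (4 * a ^ 2)) / l) (sqDist R₁ p)
      (hasDerivAt_smoothTransition t) h1
  have h3 : gradSq (logCutoff R₁ a l) p = _ :=
    gradSq_comp (g := fun r =>
      Real.smoothTransition (Real.log ((r + a ^ 2) / (4 * a ^ 2)) / l)) h2
        ((contDiff_sqDist R₁).differentiable (by simp) p)
  have h4 : deriv Real.smoothTransition t ^ 2 ≤ B ^ 2 :=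
    sq_le_sq.2 ((hB _).trans (le_abs_self B))
  rw [h3, gradSq_sqDist]
  have h5 : sqDist R₁ p / (sqDist R₁ p + a ^ 2) ≤ 1 := (div_le_one hq).2 (by nlinarith)
  calc (deriv Real.smoothTransition t *
        (1 / (4 * a ^ 2) / ((sqDist R₁ p + a ^ 2) / (4 * a ^ 2)) / l)) ^ 2 * (4 * sqDist R₁ p)
      = deriv Real.smoothTransition t ^ 2 * (sqDist R₁ p / (sqDist R₁ p + a ^ 2))
          * (4 / l ^ 2 * (1 / (sqDist R₁ p + a ^ 2))) := by
        field_simp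
    _ ≤ B ^ 2 * 1 * (4 / l ^ 2 * (1 / (sqDist R₁ p + a ^ 2))) := by gcongr
    _ = _ := by ring

end logCutoff

lemma sqDist_le_of_mem_crackSetPlus {R₁ δ : ℝ} (hR₁ : 0 < R₁) (hδ1 : δ ≤ 1) {p : ℝ × ℝ}
    (hp : p ∈ crackSetPlus R₁ δ) : sqDist R₁ p ≤ (R₁ * δ) ^ 2 := by
  obtain ⟨⟨θ, hθ, rfl⟩, h0⟩ := hp
  change 0 < R₁ * Real.sin θ at h0
  have hsin : 0 < Real.sin θ := pos_of_mul_pos_right h0 hR₁.le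
  have hπ := pi_gt_three
  rcases hθ with h | h
  · have h1 : Real.sin θ = Real.cos (π / 2 - θ) := (Real.cos_pi_div_two_sub θ).symm
    have h2 := Real.one_sub_sq_div_two_le_cos (x := π / 2 - θ)
    have h3 : (π / 2 - θ) ^ 2 ≤ δ ^ 2 := sq_le_sq' (by linarith [h.2]) (by linarith [h.1])
    have h4 := Real.sin_sq_add_cos_sq θ
    simp only [sqDist]
    have h5 : (R₁ * Real.cos θ) ^ 2 + (R₁ * Real.sin θ - R₁) ^ 2
        = R₁ ^ 2 * (2 - 2 * Real.sin θ) := by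
      linear_combination R₁ ^ 2 * h4
    rw [h5, mul_pow]
    refine mul_le_mul_of_nonneg_left ?_ (sq_nonneg _)
    linarith
  · exact absurd (Real.sin_nonpos_of_nonpos_of_neg_pi_le (x := θ) (by linarith [h.2])
      (by linarith [h.1])) (not_le.2 hsin)

lemma exists_crack_upper_bound {R₁ R₂ : ℝ} {φ : ℝ × ℝ → ℝ} {μ : ℝ} (hR₁ : 0 < R₁)
    (hR₁₂ : R₁ < R₂) (hφ : ContDiff ℝ (⊤ : ℕ∞) φ)
    (hΔ : ∀ p, fderiv ℝ (fun q => fderiv ℝ φ q (1, 0)) p (1, 0)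
      + fderiv ℝ (fun q => fderiv ℝ φ q (0, 1)) p (0, 1) = -μ * φ p)
    (hpos : ∀ p ∈ halfDisk R₂, 0 < φ p)
    (hbd : ∀ p : ℝ × ℝ, p.1 ^ 2 + p.2 ^ 2 ≤ R₂ ^ 2 → 0 ≤ p.2 → p ∉ halfDisk R₂ → φ p = 0) :
    lambda1 (halfDisk R₂) ≤ μ ∧ (∃ u, testFun (halfDisk R₂) u ∧ u ≠ 0) ∧
      ∃ C δ₂ : ℝ, 0 < C ∧ 0 < δ₂ ∧ ∀ δ, 0 < δ → δ ≤ δ₂ →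
        (∃ u, testFun (halfDisk R₂ \ crackSetPlus R₁ δ) u ∧ u ≠ 0) ∧
        lambda1 (halfDisk R₂ \ crackSetPlus R₁ δ) ≤ μ + C / |Real.log δ| := by
  have hR₂ : 0 < R₂ := hR₁.trans hR₁₂
  set B : Set (ℝ × ℝ) := Metric.closedBall ((0, R₁ / 2) : ℝ × ℝ) (R₁ / 4) with hBdef
  have hBmem : ∀ p ∈ B, (|p.1| ≤ R₁ / 4) ∧ R₁ / 4 ≤ p.2 ∧ p.2 ≤ 3 * R₁ / 4 := by
    intro p hp
    rw [hBdef, mem_closedBall_iff_norm, Prod.norm_def, max_le_iff] at hp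
    simp only [Prod.fst_sub, Prod.snd_sub, sub_zero, Real.norm_eq_abs] at hp
    have := abs_le.1 hp.2
    exact ⟨hp.1, by linarith, by linarith⟩
  have hB : B ⊆ halfDisk R₂ := by
    intro p hp
    obtain ⟨h1, h2, h3⟩ := hBmem p hp
    refine ⟨?_, ?_⟩
    · change p.1 ^ 2 + p.2 ^ 2 < R₂ ^ 2
      have h4 : p.1 ^ 2 ≤ (R₁ / 4) ^ 2 := sq_le_sq' (abs_le.1 h1).1 (abs_le.1 h1).2
      nlinarith
    · change 0 < p.2
      linarith
  have hB0 : 0 < volume.real B :=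
    ENNReal.toReal_pos (Metric.measure_closedBall_pos volume _ (by positivity)).ne'
      (isCompact_closedBall _ _).measure_lt_top.ne
  obtain ⟨c, hc, key⟩ :=
    lambda1_halfDisk_sdiff_le hφ hΔ hpos hbd (isCompact_closedBall _ _) hB hB0
  obtain ⟨S, hS0, hS⟩ := exists_deriv_smoothTransition_bound
  have hunc := key ∅ (fun _ => 1) contDiff_const (by simp) (by simp) (by simp)
  simp only [sdiff_empty, gradSq_const, mul_zero, integral_zero, add_zero] at hunc
  refine ⟨hunc.2, hunc.1, ?_⟩
  obtain ⟨F, hF⟩ := (isCompact_superlevel (φ := fun _ => 0) continuous_const R₂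
    0).exists_bound_of_continuousOn hφ.continuous.continuousOn
  set N := 2 + 1 / 2 * |Real.log (((2 * R₂) ^ 2 + 1) / (10 * R₁ / 10) ^ 2)| with hN
  have hN0 : 0 < N := by positivity
  refine ⟨c * (F ^ 2 * (4 * S ^ 2)) * (8 * N) + 1, min (1 / 64) (1 / R₁), by positivity,
    by positivity, fun δ hδ hδ2 => ?_⟩
  have hδ64 : δ ≤ 1 / 64 := hδ2.trans (min_le_left _ _)
  have hδR : δ ≤ 1 / R₁ := hδ2.trans (min_le_right _ _)
  rw [le_div_iff₀ hR₁] at hδR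
  have hl0 : Real.log δ < 0 := Real.log_neg hδ (by linarith)
  set l := |Real.log δ| with hl
  have hlpos : 0 < l := abs_pos.2 hl0.ne
  have hexp : Real.exp l = 1 / δ := by
    rw [hl, abs_of_neg hl0, Real.exp_neg, Real.exp_log hδ, one_div]
  set a := R₁ * δ with ha
  have ha0 : 0 < a := by positivity
  have ha1 : a ≤ 1 := by rw [ha]; linarith
  have hone : ∀ p ∈ B, logCutoff R₁ a l p = 1 := fun p hp => logCutoff_eq_one ha0 hlpos <| by
    obtain ⟨h1, h2, h3⟩ := hBmem p hp
    have h4 : 4 * a ^ 2 * Real.exp l = 4 * R₁ ^ 2 * δ := by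
      rw [hexp, ha]
      field_simp
    rw [h4, sqDist]
    nlinarith [sq_nonneg p.1, pow_pos hR₁ 2]
  obtain ⟨hne, hle⟩ := key (crackSetPlus R₁ δ) (logCutoff R₁ a l) (contDiff_logCutoff ha0)
    abs_logCutoff_le hone fun p hp => notMem_tsupport_logCutoff ha0 hlpos
      (sqDist_le_of_mem_crackSetPlus hR₁ (by linarith) hp)
  refine ⟨hne, hle.trans ?_⟩
  have hsub : halfDisk R₂ ⊆ {p : ℝ × ℝ | (p.1 ^ 2 + p.2 ^ 2 ≤ R₂ ^ 2 ∧ 0 ≤ p.2) ∧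
      (0 : ℝ) ≤ (fun _ : ℝ × ℝ => (0 : ℝ)) p} :=
    fun p hp => ⟨⟨le_of_lt hp.1, le_of_lt hp.2⟩, le_rfl⟩
  have hq : ∀ p, 0 < sqDist R₁ p + a ^ 2 := fun p => by
    have := sqDist_nonneg R₁ p
    positivity
  have h_int : ∀ f : ℝ × ℝ → ℝ, Continuous f → IntegrableOn f (halfDisk R₂) := fun f hf =>
    (hf.continuousOn.integrableOn_compact
      (isCompact_superlevel (φ := fun _ => 0) continuous_const R₂ 0)).mono_set hsub
  have h1 : ∫ p in halfDisk R₂, φ p ^ 2 * gradSq (logCutoff R₁ a l) p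
      ≤ F ^ 2 * (4 * S ^ 2 / l ^ 2) * (4 * Real.log (((2 * R₂) ^ 2 + a ^ 2) / a ^ 2)) := by
    refine le_trans ?_ (mul_le_mul_of_nonneg_left (setIntegral_inv_sqDist_le hR₁ hR₁₂ ha0)
      (by positivity))
    rw [← integral_const_mul]
    refine setIntegral_mono_on (h_int _ ?_) (h_int _ ?_) (isOpen_halfDisk R₂).measurableSet
      fun p hp => ?_
    · exact (hφ.continuous.pow 2).mul
        (continuous_gradSq ((contDiff_logCutoff ha0).of_le (by simp)))
    · exact continuous_const.mul (continuous_const.div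
        ((contDiff_sqDist R₁).continuous.add continuous_const) fun p => (hq p).ne')
    · have h2 : φ p ^ 2 ≤ F ^ 2 := by
        have := hF p (hsub hp)
        rw [Real.norm_of_nonneg (hpos p hp).le] at this
        exact pow_le_pow_left₀ (hpos p hp).le this 2
      rw [mul_assoc]
      exact mul_le_mul h2 (gradSq_logCutoff_le ha0 hlpos hS p) (gradSq_nonneg _ p)
        (sq_nonneg F)
  have h3 : Real.log (((2 * R₂) ^ 2 + a ^ 2) / a ^ 2) ≤ 2 * (N * l) := by
    have h4 := logFactor_le (R₁ := 10 * R₁) (B := (2 * R₂) ^ 2 + 1) (by positivity)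
      (by positivity) hδ (by linarith)
    rw [show 10 * R₁ * δ / 10 = a by rw [ha]; ring, ← hN, ← hl, logFactor] at h4
    have h5 : Real.log (((2 * R₂) ^ 2 + a ^ 2) / a ^ 2)
        ≤ Real.log (((2 * R₂) ^ 2 + 1) / a ^ 2) := by
      refine Real.log_le_log (by positivity) ?_
      gcongr
      exact pow_le_one₀ ha0.le ha1
    linarith
  have h6 : c * ∫ p in halfDisk R₂, φ p ^ 2 * gradSq (logCutoff R₁ a l) p
      ≤ c * (F ^ 2 * (4 * S ^ 2)) * (8 * N) / l := by
    calc _ ≤ c * (F ^ 2 * (4 * S ^ 2 / l ^ 2) * (4 * (2 * (N * l)))) := by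
          refine mul_le_mul_of_nonneg_left (h1.trans ?_) hc.le
          gcongr
      _ = _ := by field_simp; ring
  have h7 : c * (F ^ 2 * (4 * S ^ 2)) * (8 * N) / l
      ≤ (c * (F ^ 2 * (4 * S ^ 2)) * (8 * N) + 1) / l := by
    gcongr
    linarith
  linarith

/-- the eigenvalue shift `λ₁(B_{R₂}⁺ \ K_δ⁺) − λ₁(B_{R₂}⁺)` is of the exact
order `1/|log δ|` as `δ → 0⁺`. -/
theorem DND_shift_log_order (R₁ R₂ : ℝ) (hR₁ : 0 < R₁) (hR₁₂ : R₁ < R₂) :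
    ∃ c C δ₀ : ℝ, 0 < c ∧ 0 < C ∧ δ₀ ∈ Set.Ioo (0 : ℝ) 1 ∧
      ∀ δ ∈ Set.Ioo (0 : ℝ) δ₀,
        c / |Real.log δ| ≤ lambda1 (halfDisk R₂ \ crackSetPlus R₁ δ) - lambda1 (halfDisk R₂) ∧
        lambda1 (halfDisk R₂ \ crackSetPlus R₁ δ) - lambda1 (halfDisk R₂) ≤ C / |Real.log δ| := by
  obtain ⟨φ, μ, M, hφ, hΔ, hpos, hbd, hM, hφM⟩ := exists_halfDisk_groundState R₁ R₂ hR₁ hR₁₂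
  obtain ⟨c, δ₁, hc, hδ₁, lower⟩ := exists_crack_lower_bound hR₁ hR₁₂ hφ hΔ hpos hM hφM
  obtain ⟨hle, hne, C, δ₂, hC, hδ₂, upper⟩ := exists_crack_upper_bound hR₁ hR₁₂ hφ hΔ hpos hbd
  have heq : lambda1 (halfDisk R₂) = μ :=
    le_antisymm hle (le_lambda1 hne fun u hu => mul_integral_sq_le_gradSq hφ hΔ hpos hu)
  refine ⟨c, C, min (1 / 2) (min δ₁ δ₂), hc, hC,
    ⟨by positivity, (min_le_left _ _).trans_lt (by norm_num)⟩, fun δ hδ => ?_⟩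
  have h1 : δ ≤ δ₁ := hδ.2.le.trans ((min_le_right _ _).trans (min_le_left _ _))
  have h2 : δ ≤ δ₂ := hδ.2.le.trans ((min_le_right _ _).trans (min_le_right _ _))
  obtain ⟨hneδ, hupper⟩ := upper δ hδ.1 h2
  have hlower := le_lambda1 hneδ (lower δ hδ.1 h1)
  rw [heq]
  exact ⟨by linarith, by linarith⟩
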